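/- arXiv:2302.03346 — 8 statements merged into one kernel-verified Lean document; each statement's English description precedes it below -/
import Mathlib

section
/- In any group there is a unique largest normal locally polycyclic subgroup, and this subgroup is characteristic (invariant under all automorphisms of the group). -/
universe u v

/-- A group is polycyclic if it has a subnormal series with cyclic factors; equivalently
(peeling off the top factor of the series), it is trivial or has a polycyclic normal
subgroup with cyclic quotient. -/
inductive IsPolycyclic : ∀ (G : Type u) [Group G], Prop
  | of_subsingleton (G : Type u) [Group G] (h : Subsingleton G) : IsPolycyclic G
  | step (G : Type u) [Group G] (N : Subgroup G) (hN : N.Normal)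
      (h1 : IsPolycyclic N) (h2 : IsCyclic (G ⧸ N)) : IsPolycyclic G

/-- A group is virtually polycyclic if it has a polycyclic subgroup of finite index. -/
def IsVirtuallyPolycyclic (G : Type u) [Group G] : Prop :=
  ∃ H : Subgroup G, H.FiniteIndex ∧ IsPolycyclic H
theorem IsPolycyclic.of_inj {G : Type u} [Group G] (hG : IsPolycyclic G) :
    ∀ {H : Type u} [Group H] (f : H →* G), Function.Injective f → IsPolycyclic H := by
  induction hG with
  | of_subsingleton G h =>
    intro H _ f hf
    exact .of_subsingleton H hf.subsingleton
  | step G N hN h1 h2 ih =>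
    intro H _ f hf
    refine .step H (N.comap f) inferInstance (ih (f.subgroupComap N) ?_) ?_
    · intro a b hab
      apply Subtype.ext
      apply hf
      exact congrArg Subtype.val hab
    · refine isCyclic_of_injective (QuotientGroup.map (N.comap f) N f le_rfl) ?_
      rw [← MonoidHom.ker_eq_bot_iff, eq_bot_iff]
      intro x
      induction x using QuotientGroup.induction_on with
      | H z =>
        intro hz
        simpa [MonoidHom.mem_ker] using hz

theorem IsPolycyclic.of_surj {G : Type u} [Group G] (hG : IsPolycyclic G) :
    ∀ {H : Type u} [Group H] (f : G →* H), Function.Surjective f → IsPolycyclic H := by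
  induction hG with
  | of_subsingleton G h =>
    intro H _ f hf
    exact .of_subsingleton H hf.subsingleton
  | step G N hN h1 h2 ih =>
    intro H _ f hf
    have hn : (N.map f).Normal := hN.map f hf
    refine .step H (N.map f) hn (ih (f.subgroupMap N) (f.subgroupMap_surjective N)) ?_
    refine isCyclic_of_surjective (QuotientGroup.map N (N.map f) f (Subgroup.le_comap_map f N)) ?_
    intro x
    induction x using QuotientGroup.induction_on with
    | H z =>
      obtain ⟨y, rfl⟩ := hf z
      exact ⟨(y : G ⧸ N), rfl⟩

theorem IsPolycyclic.ext_ker {Q : Type u} [Group Q] (hQ : IsPolycyclic Q) :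
    ∀ {G : Type u} [Group G] (f : G →* Q), IsPolycyclic f.ker → IsPolycyclic G := by
  induction hQ with
  | of_subsingleton Q h =>
    intro G _ f hf
    refine hf.of_surj f.ker.subtype fun g => ⟨⟨g, ?_⟩, rfl⟩
    exact Subsingleton.elim _ _
  | step Q N hN h1 h2 ih =>
    intro G _ f hf
    refine .step G (N.comap f) inferInstance (ih (f.subgroupComap N) ?_) ?_
    · have hm : ∀ x : (f.subgroupComap N).ker, ((N.comap f).subtype.comp
          (f.subgroupComap N).ker.subtype) x ∈ f.ker := by
        intro x
        exact congrArg Subtype.val x.2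
      refine hf.of_inj (((N.comap f).subtype.comp
          (f.subgroupComap N).ker.subtype).codRestrict f.ker hm) ?_
      intro a b hab
      have h3 : ((a : N.comap f) : G) = ((b : N.comap f) : G) := congrArg (fun z : f.ker => (z : G)) hab
      exact Subtype.ext (Subtype.ext h3)
    · refine isCyclic_of_injective (QuotientGroup.map (N.comap f) N f le_rfl) ?_
      rw [← MonoidHom.ker_eq_bot_iff, eq_bot_iff]
      intro x
      induction x using QuotientGroup.induction_on with
      | H z =>
        intro hz
        simpa [MonoidHom.mem_ker] using hz

theorem IsPolycyclic.group_fg {G : Type u} [Group G] (hG : IsPolycyclic G) : Group.FG G := by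
  induction hG with
  | of_subsingleton G h => infer_instance
  | step G N hN h1 h2 ih =>
    obtain ⟨q, hq⟩ := h2.exists_generator
    obtain ⟨g, rfl⟩ := QuotientGroup.mk_surjective q
    rw [Group.fg_def]
    have hz : (Subgroup.zpowers g).FG := ⟨{g}, by simp [Subgroup.zpowers_eq_closure]⟩
    have : (⊤ : Subgroup G) = N ⊔ Subgroup.zpowers g := by
      symm
      rw [eq_top_iff]
      intro x _
      obtain ⟨k, hk⟩ := hq (x : G ⧸ N)
      have hk' : ((g ^ k : G) : G ⧸ N) = x := by simpa using hk
      rw [QuotientGroup.eq] at hk'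
      have : x = g ^ k * ((g ^ k)⁻¹ * x) := by group
      rw [this]
      exact mul_mem (Subgroup.mem_sup_right ⟨k, rfl⟩) (Subgroup.mem_sup_left hk')
    rw [this]
    exact ((Group.fg_iff_subgroup_fg N).1 ih).sup hz

/-- locally polycyclic, in terms of subgroups of the ambient group -/
def LocPoly {G : Type u} [Group G] (M : Subgroup G) : Prop :=
  ∀ F : Subgroup G, F ≤ M → F.FG → IsPolycyclic F

theorem locPoly_iff {G : Type u} [Group G] (M : Subgroup G) :
    (∀ F : Subgroup M, Group.FG F → IsPolycyclic F) ↔ LocPoly M := by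
  constructor
  · intro h F hF hfg
    have e := Subgroup.subgroupOfEquivOfLe hF
    have : Group.FG F := (Group.fg_iff_subgroup_fg F).2 hfg
    have h1 : Group.FG (F.subgroupOf M) :=
      Group.fg_of_surjective (f := e.symm.toMonoidHom) e.symm.surjective
    exact (h _ h1).of_surj e.toMonoidHom e.surjective
  · intro h F hF
    have e := F.equivMapOfInjective M.subtype M.subtype_injective
    have h1 : Group.FG (F.map M.subtype) :=
      Group.fg_of_surjective (f := e.toMonoidHom) e.surjective
    exact (h _ (Subgroup.map_subtype_le F) ((Group.fg_iff_subgroup_fg _).1 h1)).of_surj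
      e.symm.toMonoidHom e.symm.surjective

theorem IsPolycyclic.mono {G : Type u} [Group G] {H K : Subgroup G} (hK : IsPolycyclic K)
    (h : H ≤ K) : IsPolycyclic H :=
  hK.of_inj (Subgroup.inclusion h) (Subgroup.inclusion_injective h)

theorem IsPolycyclic.sup_of_norm {G : Type u} [Group G] {P L : Subgroup G} (hP : IsPolycyclic P)
    (hL : IsPolycyclic L) (h : P ≤ Subgroup.normalizer (L : Set G)) :
    IsPolycyclic (P ⊔ L : Subgroup G) := by
  have hn := Subgroup.normal_subgroupOf_sup_of_le_normalizer h
  have e := QuotientGroup.quotientInfEquivProdNormalizerQuotient P L h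
  have hn2 := Subgroup.normal_subgroupOf_of_le_normalizer h
  have hq : IsPolycyclic ((P ⊔ L : Subgroup G) ⧸ L.subgroupOf (P ⊔ L)) :=
    (hP.of_surj (QuotientGroup.mk' (L.subgroupOf P)) (QuotientGroup.mk'_surjective _)).of_surj
      e.toMonoidHom e.surjective
  refine hq.ext_ker (QuotientGroup.mk' (L.subgroupOf (P ⊔ L))) ?_
  rw [QuotientGroup.ker_mk']
  have e2 := Subgroup.subgroupOfEquivOfLe (le_sup_right : L ≤ P ⊔ L)
  exact hL.of_surj e2.symm.toMonoidHom e2.symm.surjective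

theorem LocPoly.key {G : Type u} [Group G] {M N : Subgroup G} (hMn : M.Normal) (hNn : N.Normal)
    (hM : LocPoly M) (hN : LocPoly N) {X Y : Set G} (hX : X.Finite) (hY : Y.Finite)
    (hXM : X ⊆ M) (hYN : Y ⊆ N) (hinv : ∀ x ∈ X, x⁻¹ ∈ X) :
    ∃ J : Subgroup G, X ⊆ J ∧ Y ⊆ J ∧ IsPolycyclic J := by
  set C : Set G := Set.image2 (fun x y => x * y * x⁻¹ * y⁻¹) X Y with hC
  have hCf : C.Finite := hX.image2 _ hY
  have hCM : C ⊆ M := by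
    rintro _ ⟨x, hx, y, hy, rfl⟩
    have := M.mul_mem (hXM hx) (hMn.conj_mem _ (M.inv_mem (hXM hx)) y)
    simpa [mul_assoc] using this
  have hCN : C ⊆ N := by
    rintro _ ⟨x, hx, y, hy, rfl⟩
    exact N.mul_mem (hNn.conj_mem _ (hYN hy) x) (N.inv_mem (hYN hy))
  set P := Subgroup.closure (X ∪ C) with hPdef
  have hXP : X ⊆ P := fun x hx => Subgroup.subset_closure (Or.inl hx)
  have hCP : C ⊆ P := fun x hx => Subgroup.subset_closure (Or.inr hx)
  have hP : IsPolycyclic P := by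
    refine hM P ((Subgroup.closure_le _).2 (Set.union_subset hXM hCM)) ?_
    exact (Subgroup.fg_iff P).2 ⟨_, rfl, hX.union hCf⟩
  have hD : (N ⊓ P).FG := (Group.fg_iff_subgroup_fg _).1 (hP.mono inf_le_right).group_fg
  set L := Subgroup.closure Y ⊔ (N ⊓ P) with hLdef
  have hL : IsPolycyclic L := by
    refine hN L (sup_le ((Subgroup.closure_le _).2 hYN) inf_le_left) ?_
    exact ((Subgroup.fg_iff _).2 ⟨_, rfl, hY⟩).sup hD
  have hconj : ∀ x ∈ X, ∀ l ∈ L, x * l * x⁻¹ ∈ L := by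
    intro x hx
    have : L ≤ L.comap (MulAut.conj x).toMonoidHom := by
      refine sup_le ((Subgroup.closure_le _).2 ?_) ?_
      · intro y hy
        have h1 : x * y * x⁻¹ * y⁻¹ ∈ C := ⟨x, hx, y, hy, rfl⟩
        have h2 : x * y * x⁻¹ * y⁻¹ ∈ L := Subgroup.mem_sup_right ⟨hCN h1, hCP h1⟩
        have h3 : y ∈ L := Subgroup.mem_sup_left (Subgroup.subset_closure hy)
        have := L.mul_mem h2 h3
        simpa using this
      · rintro d ⟨hd1, hd2⟩
        have hxP := hXP hx
        exact Subgroup.mem_sup_right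
          ⟨hNn.conj_mem _ hd1 x, P.mul_mem (P.mul_mem hxP hd2) (P.inv_mem hxP)⟩
    intro l hl
    exact this hl
  have hnorm : P ≤ Subgroup.normalizer (L : Set G) := by
    refine (Subgroup.closure_le _).2 (Set.union_subset ?_ ?_)
    · intro x hx
      refine Subgroup.mem_normalizer_iff.2 fun h => ⟨hconj x hx h, fun hh => ?_⟩
      have := hconj _ (hinv x hx) _ hh
      simpa [mul_assoc] using this
    · intro c hc
      exact Subgroup.le_normalizer
        (Subgroup.mem_sup_right ⟨hCN hc, hCP hc⟩ : c ∈ L)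
  refine ⟨P ⊔ L, fun x hx => Subgroup.mem_sup_left (hXP hx), fun y hy => ?_,
    hP.sup_of_norm hL hnorm⟩
  exact Subgroup.mem_sup_right (Subgroup.mem_sup_left (Subgroup.subset_closure hy))

theorem LocPoly.sup {G : Type u} [Group G] {M N : Subgroup G} (hMn : M.Normal) (hNn : N.Normal)
    (hM : LocPoly M) (hN : LocPoly N) : LocPoly (M ⊔ N) := by
  intro F hF hfg
  obtain ⟨S, hS, hSf⟩ := (Subgroup.fg_iff F).1 hfg
  have h : ∀ s : G, ∃ m ∈ M, ∃ n ∈ N, s ∈ S → m * n = s := by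
    intro s
    by_cases hs : s ∈ S
    · have h1 : s ∈ M ⊔ N := hF (hS ▸ Subgroup.subset_closure hs)
      obtain ⟨m, hm, n, hn, e⟩ := Subgroup.mem_sup_of_normal_right.1 h1
      exact ⟨m, hm, n, hn, fun _ => e⟩
    · exact ⟨1, M.one_mem, 1, N.one_mem, fun h => absurd h hs⟩
  choose m hm n hn e using h
  obtain ⟨J, h1, h2, h3⟩ := LocPoly.key hMn hNn hM hN (X := m '' S ∪ (fun s => (m s)⁻¹) '' S)
    (Y := n '' S) ((hSf.image _).union (hSf.image _)) (hSf.image _)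
    (by
      rintro _ (⟨s, _, rfl⟩ | ⟨s, _, rfl⟩)
      · exact hm s
      · exact M.inv_mem (hm s))
    (by rintro _ ⟨s, _, rfl⟩; exact hn s)
    (by
      rintro _ (⟨s, hs, rfl⟩ | ⟨s, hs, rfl⟩)
      · exact Or.inr ⟨s, hs, rfl⟩
      · exact Or.inl ⟨s, hs, by simp⟩)
  refine h3.mono ?_
  rw [← hS, Subgroup.closure_le]
  intro s hs
  rw [← e s hs]
  exact J.mul_mem (h1 (Or.inl ⟨s, hs, rfl⟩)) (h2 ⟨s, hs, rfl⟩)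

theorem LocPoly.sSup {G : Type u} [Group G] :
    LocPoly (sSup {M : Subgroup G | M.Normal ∧ LocPoly M}) := by
  intro F hF hfg
  have hbot : (⊥ : Subgroup G) ∈ {M : Subgroup G | M.Normal ∧ LocPoly M} := by
    refine ⟨inferInstance, fun F hF _ => .of_subsingleton _ ?_⟩
    rw [le_bot_iff.1 hF]
    infer_instance
  have hdir : DirectedOn (· ≤ ·) {M : Subgroup G | M.Normal ∧ LocPoly M} := by
    rintro A ⟨hA, hA'⟩ B ⟨hB, hB'⟩
    exact ⟨A ⊔ B, ⟨Subgroup.sup_normal A B, hA'.sup hA hB hB'⟩, le_sup_left, le_sup_right⟩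
  obtain ⟨S, hS, hSf⟩ := (Subgroup.fg_iff F).1 hfg
  have hSs : S ⊆ (SupSet.sSup {M : Subgroup G | M.Normal ∧ LocPoly M} : Subgroup G) := by
    intro s hs
    exact hF (hS ▸ Subgroup.subset_closure hs)
  have : ∃ M : Subgroup G, (M.Normal ∧ LocPoly M) ∧ S ⊆ M := by
    clear hS
    induction S, hSf using Set.Finite.induction_on with
    | empty => exact ⟨⊥, hbot, by simp⟩
    | @insert a S _ _ ih =>
      obtain ⟨A, hA, hSA⟩ := ih (fun x hx => hSs (Or.inr hx))
      obtain ⟨B, hB, haB⟩ := (Subgroup.mem_sSup_of_directedOn ⟨_, hbot⟩ hdir).1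
        (hSs (Set.mem_insert a S))
      obtain ⟨D, hD, h1, h2⟩ := hdir A hA B hB
      exact ⟨D, hD, Set.insert_subset (h2 haB) (fun x hx => h1 (hSA hx))⟩
  obtain ⟨M, hM, hSM⟩ := this
  refine hM.2 F ?_ hfg
  rw [← hS, Subgroup.closure_le]
  exact hSM

theorem LocPoly.map {G : Type u} [Group G] {M : Subgroup G} (hM : LocPoly M) (e : G ≃* G) :
    LocPoly (M.map e.toMonoidHom) := by
  intro F hF hfg
  have e2 := F.equivMapOfInjective e.symm.toMonoidHom e.symm.injective
  have : Group.FG F := (Group.fg_iff_subgroup_fg F).2 hfg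
  have h1 : Group.FG (F.map e.symm.toMonoidHom) :=
    Group.fg_of_surjective (f := e2.toMonoidHom) e2.surjective
  refine (hM _ ?_ ((Group.fg_iff_subgroup_fg _).1 h1)).of_surj e2.symm.toMonoidHom
    e2.symm.surjective
  rintro _ ⟨x, hx, rfl⟩
  obtain ⟨y, hy, rfl⟩ := hF hx
  simpa using hy

/-- In any group there is a unique largest normal locally polycyclic subgroup, and this
subgroup is characteristic. -/
theorem exists_unique_largest_normal_locallyPolycyclic (G : Type u) [Group G] :
    ∃! N : Subgroup G,
      N.Normal ∧ (∀ F : Subgroup N, Group.FG F → IsPolycyclic F) ∧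
        (∀ M : Subgroup G, M.Normal → (∀ F : Subgroup M, Group.FG F → IsPolycyclic F) →
          M ≤ N) ∧
        N.Characteristic := by
  simp only [locPoly_iff]
  have hchar : (sSup {M : Subgroup G | M.Normal ∧ LocPoly M}).Characteristic := by
    rw [Subgroup.characteristic_iff_map_le]
    intro φ
    rw [Subgroup.map_le_iff_le_comap]
    refine sSup_le ?_
    rintro M ⟨hM, hM'⟩
    rw [← Subgroup.map_le_iff_le_comap]
    exact le_sSup ⟨hM.map _ φ.surjective, hM'.map φ⟩
  refine ⟨sSup {M : Subgroup G | M.Normal ∧ LocPoly M},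
    ⟨inferInstance, LocPoly.sSup, fun M h1 h2 => le_sSup ⟨h1, h2⟩, hchar⟩, ?_⟩
  rintro K ⟨h1, h2, h3, _⟩
  exact le_antisymm (le_sSup ⟨h1, h2⟩) (h3 _ inferInstance LocPoly.sSup)
end

section
/- Suppose a group G has a subgroup H of finite index which is an ascending HNN extension with virtually polycyclic vertex group. Then G itself is virtually polycyclic or G is an ascending HNN extension with virtually polycyclic vertex group. -/
universe u v

/-- `G` is an ascending HNN extension with vertex group `B` and stable letter `t` if `G` is
generated by `B` together with `t`, and `t⁻¹ * B * t ⊇ B` (equivalently, `t * B * t⁻¹ ⊆ B`). -/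
def IsAscendingHNN (G : Type u) [Group G] (B : Subgroup G) (t : G) : Prop :=
  Subgroup.closure ((B : Set G) ∪ {t}) = ⊤ ∧ ∀ b ∈ B, t * b * t⁻¹ ∈ B

/-- The HNN extension is properly ascending if moreover `t⁻¹ * B * t` strictly contains `B`. -/
def IsProperlyAscendingHNN (G : Type u) [Group G] (B : Subgroup G) (t : G) : Prop :=
  IsAscendingHNN G B t ∧ ∃ b ∈ B, t⁻¹ * b * t ∉ B

theorem poly_of_injective {B : Type u} [Group B] (hB : IsPolycyclic B) :
    ∀ {A : Type u} [Group A] (f : A →* B), Function.Injective f → IsPolycyclic A := by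
  induction hB with
  | of_subsingleton G h =>
    intro A _ f hf
    exact IsPolycyclic.of_subsingleton A (hf.subsingleton)
  | step G N hN h1 h2 ih =>
    intro A _ f hf
    refine IsPolycyclic.step A (N.comap f) inferInstance ?_ ?_
    · refine ih ((f.comp (N.comap f).subtype).codRestrict N (fun x => x.2)) ?_
      intro x y hxy
      have := congrArg Subtype.val hxy
      exact Subtype.ext (hf this)
    · let q : A ⧸ (N.comap f) →* G ⧸ N := QuotientGroup.map _ _ f le_rfl
      refine isCyclic_of_injective q ?_
      rw [← MonoidHom.ker_eq_bot_iff, eq_bot_iff]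
      intro x
      induction x using QuotientGroup.induction_on with
      | H z =>
        intro hz
        have hz' : ((f z : G) : G ⧸ N) = 1 := hz
        rw [QuotientGroup.eq_one_iff] at hz'
        rw [Subgroup.mem_bot, QuotientGroup.eq_one_iff]
        exact hz'

theorem poly_fg {G : Type u} [Group G] (h : IsPolycyclic G) : Group.FG G := by
  induction h with
  | of_subsingleton G h => infer_instance
  | step G N hN h1 h2 ih =>
    obtain ⟨x, hx⟩ := h2.exists_generator
    obtain ⟨g, rfl⟩ := QuotientGroup.mk_surjective x
    have hNfg : N.FG := (Group.fg_iff_subgroup_fg N).1 ih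
    have hg : (Subgroup.zpowers g).FG := ⟨{g}, by simp [Subgroup.zpowers_eq_closure]⟩
    have : N ⊔ Subgroup.zpowers g = ⊤ := by
      rw [eq_top_iff]
      intro y _
      obtain ⟨i, hi⟩ := hx (y : G ⧸ N)
      have h3 : ((g ^ i : G) : G ⧸ N) = y := by simpa using hi
      rw [QuotientGroup.eq] at h3
      have h4 : g ^ i * ((g ^ i)⁻¹ * y) ∈ N ⊔ Subgroup.zpowers g :=
        mul_mem (Subgroup.mem_sup_right ⟨i, rfl⟩) (Subgroup.mem_sup_left h3)
      simpa using h4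
    exact ⟨this ▸ hNfg.sup hg⟩

theorem fg_of_finiteIndex {G : Type u} [Group G] (H : Subgroup G) [H.FiniteIndex]
    (h : H.FG) : Group.FG G := by
  have : Finite (G ⧸ H) := Subgroup.finite_quotient_of_finiteIndex
  have hfin : (Set.range (Quotient.out : G ⧸ H → G)).Finite :=
    Set.finite_range (ι := G ⧸ H) _
  have h2 : (Subgroup.closure (Set.range (Quotient.out : G ⧸ H → G))).FG :=
    ⟨hfin.toFinset, by simp⟩
  have : Subgroup.closure (Set.range (Quotient.out : G ⧸ H → G)) ⊔ H = ⊤ := by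
    rw [eq_top_iff]
    intro y _
    have h3 : (((y : G ⧸ H).out : G) : G ⧸ H) = y := QuotientGroup.out_eq' _
    rw [QuotientGroup.eq] at h3
    have h4 : (y : G ⧸ H).out * ((y : G ⧸ H).out⁻¹ * y) ∈
        Subgroup.closure (Set.range (Quotient.out : G ⧸ H → G)) ⊔ H := mul_mem
      (Subgroup.mem_sup_left (Subgroup.subset_closure ⟨(y : G ⧸ H), rfl⟩)) (Subgroup.mem_sup_right h3)
    simpa using h4
  exact ⟨this ▸ h2.sup h⟩

theorem vp_fg {G : Type u} [Group G] (h : IsVirtuallyPolycyclic G) : Group.FG G := by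
  obtain ⟨H, hH, hp⟩ := h
  exact fg_of_finiteIndex H ((Group.fg_iff_subgroup_fg H).1 (poly_fg hp))

theorem vp_of_injective {A B : Type u} [Group A] [Group B] (hB : IsVirtuallyPolycyclic B)
    (f : A →* B) (hf : Function.Injective f) : IsVirtuallyPolycyclic A := by
  obtain ⟨H, hH, hp⟩ := hB
  refine ⟨H.comap f, ?_, ?_⟩
  · refine ⟨?_⟩
    rw [Subgroup.index_comap]
    have := Subgroup.isFiniteRelIndex_of_finiteIndex (H := H) (K := f.range)
    exact Subgroup.relIndex_ne_zero
  · refine poly_of_injective hp ((f.comp (H.comap f).subtype).codRestrict H (fun x => x.2)) ?_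
    intro x y hxy
    have := congrArg Subtype.val hxy
    exact Subtype.ext (hf this)

theorem vp_of_finiteIndex {G : Type u} [Group G] (H : Subgroup G) (hH : H.FiniteIndex)
    (h : IsVirtuallyPolycyclic H) : IsVirtuallyPolycyclic G := by
  obtain ⟨K, hK, hp⟩ := h
  refine ⟨K.map H.subtype, ⟨?_⟩, ?_⟩
  · rw [Subgroup.index_map_subtype]
    exact mul_ne_zero hK.index_ne_zero hH.index_ne_zero
  · let e := K.equivMapOfInjective H.subtype H.subtype_injective
    exact poly_of_injective hp e.symm.toMonoidHom e.symm.injective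

theorem vp_mono {G : Type u} [Group G] {K L : Subgroup G} (h : K ≤ L)
    (hL : IsVirtuallyPolycyclic L) : IsVirtuallyPolycyclic K :=
  vp_of_injective hL (Subgroup.inclusion h) (Subgroup.inclusion_injective h)

theorem exists_char {Q : Type u} [Group Q] (h : IsVirtuallyPolycyclic Q) :
    ∃ P : Subgroup Q, P.FiniteIndex ∧ IsPolycyclic P ∧
      ∀ (e : Q →* Q), ∀ x ∈ P, e x ∈ P := by
  have hfg := vp_fg h
  obtain ⟨H, hH, hp⟩ := h
  obtain ⟨S, hS⟩ := hfg.out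
  let n := Nat.card (Q ⧸ H)
  let eq : (Q ⧸ H) ≃ Fin n := Finite.equivFin _
  have hfin : Finite (Q →* Equiv.Perm (Fin n)) := by
    refine Finite.of_injective (fun φ => fun s : S => φ s) ?_
    intro φ ψ hφ
    refine MonoidHom.eq_of_eqOn_dense hS ?_
    intro s hs
    exact congrFun hφ ⟨s, hs⟩
  have hle : (⨅ φ : Q →* Equiv.Perm (Fin n), φ.ker) ≤ H := by
    intro x hx
    let φ : Q →* Equiv.Perm (Fin n) :=
      (eq.permCongrHom.toMonoidHom).comp (MulAction.toPermHom Q (Q ⧸ H))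
    have h1 : φ x = 1 := Subgroup.mem_iInf.1 hx φ
    have h2 : MulAction.toPermHom Q (Q ⧸ H) x = 1 := by
      apply eq.permCongrHom.injective
      rw [map_one]; exact h1
    have h3 : (x • ((1 : Q) : Q ⧸ H)) = ((1 : Q) : Q ⧸ H) := by
      have := congrArg (fun p => p ((1 : Q) : Q ⧸ H)) h2
      simpa using this
    have h4 : ((x * 1 : Q) : Q ⧸ H) = ((1 : Q) : Q ⧸ H) := h3
    rw [eq_comm, QuotientGroup.eq] at h4
    simpa using h4
  refine ⟨⨅ φ : Q →* Equiv.Perm (Fin n), φ.ker, ?_, ?_, ?_⟩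
  · exact Subgroup.finiteIndex_iInf (fun φ => inferInstance)
  · exact poly_of_injective hp (Subgroup.inclusion hle) (Subgroup.inclusion_injective hle)
  · intro e x hx
    rw [Subgroup.mem_iInf] at hx ⊢
    intro φ
    exact hx (φ.comp e)

theorem vp_of_ker {G : Type u} [Group G] (f : G →* Multiplicative ℤ)
    (h : IsVirtuallyPolycyclic f.ker) : IsVirtuallyPolycyclic G := by
  obtain ⟨P, hPi, hPp, hPc⟩ := exists_char h
  have hcyc : IsCyclic f.range := inferInstance
  obtain ⟨⟨_, s, rfl⟩, hs⟩ := hcyc.exists_generator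
  have hs' : ∀ g : G, ∃ i : ℤ, f g = f s ^ i := by
    intro g
    obtain ⟨i, hi⟩ := hs ⟨f g, g, rfl⟩
    exact ⟨i, (congrArg Subtype.val hi).symm⟩
  let P' := P.map f.ker.subtype
  have hP'n : P'.Normal := by
    refine ⟨?_⟩
    rintro _ ⟨x, hx, rfl⟩ g
    exact ⟨MulAut.conjNormal g x, hPc (MulAut.conjNormal g : MulAut f.ker).toMonoidHom x hx, by simp⟩
  let U := P' ⊔ Subgroup.zpowers s
  refine ⟨U, ?_, ?_⟩
  · rw [Subgroup.finiteIndex_iff_finite_quotient]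
    let m : f.ker ⧸ P → G ⧸ U := Quotient.map' (fun x => (x : G)) (by
      intro a b hab
      rw [QuotientGroup.leftRel_apply] at hab ⊢
      exact Subgroup.mem_sup_left ⟨_, hab, by simp⟩)
    refine Finite.of_surjective m ?_
    intro y
    obtain ⟨g, rfl⟩ := QuotientGroup.mk_surjective y
    obtain ⟨i, hi⟩ := hs' g
    refine ⟨QuotientGroup.mk ⟨g * (s ^ i)⁻¹, ?_⟩, ?_⟩
    · rw [MonoidHom.mem_ker]; simp [hi]
    · change ((g * (s ^ i)⁻¹ : G) : G ⧸ U) = g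
      rw [QuotientGroup.eq]
      refine Subgroup.mem_sup_right ⟨i, ?_⟩
      simp
  · refine IsPolycyclic.step U (P'.subgroupOf U) inferInstance ?_ ?_
    · let e := P.equivMapOfInjective f.ker.subtype f.ker.subtype_injective
      have h1 : IsPolycyclic P' := poly_of_injective hPp e.symm.toMonoidHom e.symm.injective
      let e2 := Subgroup.subgroupOfEquivOfLe (show P' ≤ U from le_sup_left)
      exact poly_of_injective h1 e2.toMonoidHom e2.injective
    · let j : Subgroup.zpowers s →* U ⧸ (P'.subgroupOf U) :=
        (QuotientGroup.mk' _).comp (Subgroup.inclusion le_sup_right)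
      refine isCyclic_of_surjective j ?_
      intro y
      obtain ⟨⟨g, hg⟩, rfl⟩ := QuotientGroup.mk_surjective y
      obtain ⟨p, hp, z, hz, rfl⟩ := Subgroup.mem_sup_of_normal_left.1 hg
      refine ⟨⟨z, hz⟩, ?_⟩
      change (QuotientGroup.mk _ : U ⧸ (P'.subgroupOf U)) = _
      rw [QuotientGroup.eq, Subgroup.mem_subgroupOf]
      simp only [Subgroup.coe_mul, Subgroup.coe_inv, Subgroup.coe_inclusion]
      have := hP'n.conj_mem p hp z⁻¹
      simpa [mul_assoc] using this

structure AscData {G : Type u} [Group G] (H : Subgroup G) (f : G → ℤ) (B : Subgroup G) (t : G) :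
    Prop where
  hom : ∀ x ∈ H, ∀ y ∈ H, f (x * y) = f x + f y
  BH : B ≤ H
  Bf : ∀ b ∈ B, f b = 0
  tH : t ∈ H
  tf : f t = 1
  tB : ∀ b ∈ B, t * b * t⁻¹ ∈ B
  asc : ∀ x ∈ H, f x = 0 → ∃ j : ℕ, t ^ j * x * (t ^ j)⁻¹ ∈ B
  vp : IsVirtuallyPolycyclic B

theorem hom_one {G : Type u} [Group G] {H : Subgroup G} {f : G → ℤ}
    (hom : ∀ x ∈ H, ∀ y ∈ H, f (x * y) = f x + f y) : f 1 = 0 := by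
  have := hom 1 H.one_mem 1 H.one_mem
  rw [mul_one] at this; omega

theorem hom_inv {G : Type u} [Group G] {H : Subgroup G} {f : G → ℤ}
    (hom : ∀ x ∈ H, ∀ y ∈ H, f (x * y) = f x + f y) {x : G} (hx : x ∈ H) : f x⁻¹ = - f x := by
  have := hom x hx x⁻¹ (H.inv_mem hx)
  rw [mul_inv_cancel, hom_one hom] at this; omega

theorem hom_conj {G : Type u} [Group G] {H : Subgroup G} {f : G → ℤ}
    (hom : ∀ x ∈ H, ∀ y ∈ H, f (x * y) = f x + f y) {x g : G} (hx : x ∈ H) (hg : g ∈ H) :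
    f (g * x * g⁻¹) = f x := by
  rw [hom _ (H.mul_mem hg hx) _ (H.inv_mem hg), hom _ hg _ hx, hom_inv hom hg]; omega

theorem hom_pow {G : Type u} [Group G] {H : Subgroup G} {f : G → ℤ}
    (hom : ∀ x ∈ H, ∀ y ∈ H, f (x * y) = f x + f y) {x : G} (hx : x ∈ H) (n : ℕ) :
    f (x ^ n) = n * f x := by
  induction n with
  | zero => simp [hom_one hom]
  | succ n ih =>
    rw [pow_succ, hom _ (H.pow_mem hx n) _ hx, ih]; push_cast; ring

theorem hom_zpow {G : Type u} [Group G] {H : Subgroup G} {f : G → ℤ}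
    (hom : ∀ x ∈ H, ∀ y ∈ H, f (x * y) = f x + f y) {x : G} (hx : x ∈ H) (n : ℤ) :
    f (x ^ n) = n * f x := by
  cases n with
  | ofNat n => simpa using hom_pow hom hx n
  | negSucc n =>
    rw [zpow_negSucc, hom_inv hom (H.pow_mem hx _), hom_pow hom hx]
    rw [Int.negSucc_eq]; push_cast; ring

theorem conj_pow_mem {G : Type u} [Group G] {B : Subgroup G} {t : G}
    (h : ∀ b ∈ B, t * b * t⁻¹ ∈ B) (n : ℕ) : ∀ b ∈ B, t ^ n * b * (t ^ n)⁻¹ ∈ B := by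
  induction n with
  | zero => simp
  | succ n ih =>
    intro b hb
    have := h _ (ih b hb)
    rw [pow_succ']
    simpa [mul_assoc] using this

theorem AscData.rebase {G : Type u} [Group G] {H : Subgroup G} {f : G → ℤ} {B : Subgroup G} {t : G}
    (D : AscData H f B t) (L : Subgroup G) (hLH : L ≤ H) (hLf : ∀ x ∈ L, f x = 0) (hL : L.FG)
    (s : G) (hs : s ∈ H) (hsf : 0 ≤ f s) :
    ∃ C : Subgroup G, IsVirtuallyPolycyclic C ∧ C ≤ H ∧ (∀ x ∈ C, f x = 0) ∧ L ≤ C ∧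
      (∀ x ∈ C, s * x * s⁻¹ ∈ C) ∧
      (0 < f s → ∀ x ∈ H, f x = 0 → ∃ j : ℕ, s ^ j * x * (s ^ j)⁻¹ ∈ C) := by
  obtain ⟨k, hk⟩ := Int.eq_ofNat_of_zero_le hsf
  -- monotonicity
  have mono : ∀ i j : ℕ, i ≤ j → ∀ x, t ^ i * x * (t ^ i)⁻¹ ∈ B → t ^ j * x * (t ^ j)⁻¹ ∈ B := by
    intro i j hij x hx
    obtain ⟨d, rfl⟩ := Nat.exists_eq_add_of_le hij
    have := conj_pow_mem D.tB d _ hx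
    rw [add_comm, pow_add]
    simpa [mul_assoc] using this
  obtain ⟨n, hn⟩ : ∃ n, n = (t ^ k)⁻¹ * s := ⟨_, rfl⟩
  have hsn : s = t ^ k * n := by rw [hn]; simp
  have htk := H.pow_mem D.tH k
  have hnH : n ∈ H := hn ▸ H.mul_mem (H.inv_mem htk) hs
  have hnf : f n = 0 := by
    have := D.hom _ htk _ hnH
    rw [← hsn, hom_pow D.hom D.tH, D.tf, hk] at this
    omega
  obtain ⟨j0, hj0⟩ := D.asc n hnH hnf
  obtain ⟨S, hS⟩ := hL
  have hSL : ∀ x ∈ S, x ∈ L := fun x hx => hS ▸ Subgroup.subset_closure hx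
  have : ∀ x : G, ∃ j : ℕ, x ∈ L → t ^ j * x * (t ^ j)⁻¹ ∈ B := by
    intro x
    by_cases hx : x ∈ L
    · obtain ⟨j, hj⟩ := D.asc x (hLH hx) (hLf x hx)
      exact ⟨j, fun _ => hj⟩
    · exact ⟨0, fun h => absurd h hx⟩
  choose J hJ using this
  let m := max j0 (S.sup J)
  let C := B.comap (MulAut.conj (t ^ m)).toMonoidHom
  have memC : ∀ x, x ∈ C ↔ t ^ m * x * (t ^ m)⁻¹ ∈ B := fun x => Iff.rfl
  have hnC : n ∈ C := (memC n).2 (mono _ _ (le_max_left _ _) _ hj0)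
  have hBC : B ≤ C := fun b hb => (memC b).2 (conj_pow_mem D.tB m b hb)
  have htC : ∀ x ∈ C, t * x * t⁻¹ ∈ C := by
    intro x hx
    rw [memC] at hx ⊢
    have := D.tB _ hx
    have e : t ^ m * (t * x * t⁻¹) * (t ^ m)⁻¹ = t * (t ^ m * x * (t ^ m)⁻¹) * t⁻¹ := by
      have : t ^ m * t = t * t ^ m := by rw [← pow_succ, pow_succ']
      calc t ^ m * (t * x * t⁻¹) * (t ^ m)⁻¹ = (t ^ m * t) * x * (t ^ m * t)⁻¹ := by group
        _ = (t * t ^ m) * x * (t * t ^ m)⁻¹ := by rw [this]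
        _ = _ := by group
    rw [e]; exact this
  refine ⟨C, ?_, ?_, ?_, ?_, ?_, ?_⟩
  · refine vp_of_injective D.vp
      (((MulAut.conj (t ^ m)).toMonoidHom.comp C.subtype).codRestrict B (fun x => x.2)) ?_
    intro x y hxy
    have := congrArg Subtype.val hxy
    exact Subtype.ext ((MulAut.conj (t ^ m)).injective this)
  · intro x hx
    have h1 := D.BH ((memC x).1 hx)
    have htm := H.pow_mem D.tH m
    have := H.mul_mem (H.mul_mem (H.inv_mem htm) h1) htm
    simpa [mul_assoc] using this
  · intro x hx
    have h1 := D.Bf _ ((memC x).1 hx)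
    have h2 := D.BH ((memC x).1 hx)
    have htm := H.pow_mem D.tH m
    rw [← hom_conj D.hom h2 (H.inv_mem htm)] at h1
    simpa [mul_assoc] using h1
  · rw [← hS, Subgroup.closure_le]
    intro x hx
    exact (memC x).2 (mono _ _ ((Finset.le_sup (f := J) hx).trans (le_max_right _ _)) _ (hJ x (hSL x hx)))
  · intro x hx
    have := conj_pow_mem htC k _ (C.mul_mem (C.mul_mem hnC hx) (C.inv_mem hnC))
    rw [hsn]
    simpa [mul_assoc] using this
  · intro hpos x hx hfx
    have key : ∀ j : ℕ, ∀ x, t ^ (k * j) * x * (t ^ (k * j))⁻¹ ∈ C → s ^ j * x * (s ^ j)⁻¹ ∈ C := by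
      intro j
      induction j with
      | zero => intro x hx; simpa using hx
      | succ j ih =>
        intro x hx
        have h1 := conj_pow_mem htC k _ hnC
        have h2 := conj_pow_mem htC (k * j) _ h1
        have h3 := ih (s * x * s⁻¹) (by
          have := C.mul_mem (C.mul_mem h2 hx) (C.inv_mem h2)
          rw [Nat.mul_succ, pow_add] at this
          rw [hsn]
          simpa [mul_assoc] using this)
        rw [pow_succ]
        simpa [mul_assoc] using h3
    obtain ⟨i, hi⟩ := D.asc x hx hfx
    refine ⟨i, key i x (hBC (mono i (k * i) ?_ x hi))⟩
    have : 0 < k := by omega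
    exact Nat.le_mul_of_pos_left i this

/-- restriction of a partial hom to a subgroup -/
def resHom {G : Type u} [Group G] {H : Subgroup G} {f : G → ℤ}
    (hom : ∀ x ∈ H, ∀ y ∈ H, f (x * y) = f x + f y) : H →* Multiplicative ℤ :=
  MonoidHom.mk' (fun x => Multiplicative.ofAdd (f x)) (fun x y => by
    rw [← ofAdd_add, ← hom _ x.2 _ y.2]; rfl)

theorem AscData.vp_of_neg {G : Type u} [Group G] {H : Subgroup G} {f : G → ℤ} {B : Subgroup G}
    {t : G} (D : AscData H f B t) (H0 : Subgroup G) (hn : H0.Normal) (hle : H0 ≤ H) (g s : G)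
    (hs : s ∈ H0) (hs1 : 0 < f s) (hs2 : f (g⁻¹ * s * g) ≤ 0) : IsVirtuallyPolycyclic H0 := by
  have cj : ∀ x ∈ H0, g⁻¹ * x * g ∈ H0 := fun x hx => by simpa using hn.conj_mem x hx g⁻¹
  have homg : ∀ x ∈ H0, ∀ y ∈ H0, f (g⁻¹ * (x * y) * g) = f (g⁻¹ * x * g) + f (g⁻¹ * y * g) := by
    intro x hx y hy
    rw [← D.hom _ (hle (cj x hx)) _ (hle (cj y hy))]
    congr 1; group
  obtain ⟨B1, hB1v, hB1H, hB1f, -, hB1s, hB1a⟩ := D.rebase ⊥ bot_le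
    (by intro x hx; rw [Subgroup.mem_bot.1 hx]; exact hom_one D.hom) Subgroup.FG.bot s (hle hs) hs1.le
  have hB1a := hB1a hs1
  -- M
  let M : Subgroup G := (resHom (f := fun x => f (g⁻¹ * x * g)) homg).ker.map H0.subtype
  have memM : ∀ x, x ∈ M ↔ x ∈ H0 ∧ f (g⁻¹ * x * g) = 0 := by
    intro x
    constructor
    · rintro ⟨y, hy, rfl⟩
      exact ⟨y.2, hy⟩
    · rintro ⟨h1, h2⟩
      exact ⟨⟨x, h1⟩, h2, rfl⟩
  let B2 := B1 ⊓ M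
  have hB2 : B2.FG := (Group.fg_iff_subgroup_fg _).1 (vp_fg (vp_mono inf_le_left hB1v))
  let L := B2.map (MulAut.conj g⁻¹).toMonoidHom
  have hL : L.FG := by
    obtain ⟨S, hS⟩ := hB2
    classical
    refine ⟨S.image (MulAut.conj g⁻¹), ?_⟩
    change _ = B2.map (MulAut.conj g⁻¹).toMonoidHom
    rw [← hS, MonoidHom.map_closure]; simp
  have hLm : ∀ x ∈ B2, g⁻¹ * x * g ∈ L := fun x hx => ⟨x, hx, by simp⟩
  have hLm' : ∀ y ∈ L, ∃ x ∈ B2, y = g⁻¹ * x * g := by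
    rintro _ ⟨x, hx, rfl⟩
    exact ⟨x, hx, by simp⟩
  have hsi := H0.inv_mem hs
  have hs' : f (g⁻¹ * s⁻¹ * g) = - f (g⁻¹ * s * g) := by
    rw [← hom_inv D.hom (hle (cj _ hs))]; congr 1; group
  obtain ⟨C, hCv, hCH, hCf, hLC, hCs, -⟩ := D.rebase L
    (by intro y hy
        obtain ⟨x, hx, rfl⟩ := hLm' y hy
        exact hle (cj x ((memM x).1 hx.2).1))
    (by intro y hy
        obtain ⟨x, hx, rfl⟩ := hLm' y hy
        exact ((memM x).1 hx.2).2) hL (g⁻¹ * s⁻¹ * g) (hle (cj _ hsi)) (by omega)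
  have key : ∀ x ∈ H0, f x = 0 → f (g⁻¹ * x * g) = 0 → g⁻¹ * x * g ∈ C := by
    intro x hx h1 h2
    obtain ⟨j, hj⟩ := hB1a x (hle hx) h1
    have hsj := H0.pow_mem hs j
    have h3 : s ^ j * x * (s ^ j)⁻¹ ∈ M := by
      rw [memM]
      refine ⟨H0.mul_mem (H0.mul_mem hsj hx) (H0.inv_mem hsj), ?_⟩
      rw [← h2, ← hom_conj D.hom (hle (cj x hx)) (hle (cj _ hsj))]
      congr 1; group
    have h4 := conj_pow_mem hCs j _ (hLC (hLm _ ⟨hj, h3⟩))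
    have h5 : (g⁻¹ * s⁻¹ * g) ^ j = g⁻¹ * (s ^ j)⁻¹ * g := by
      have := conj_pow (a := g⁻¹) (b := s⁻¹) (i := j)
      simpa using this
    rw [h5] at h4
    convert h4 using 1
    group
  apply vp_of_ker (resHom (H := H0) (f := f) (fun x hx y hy => D.hom x (hle hx) y (hle hy)))
  apply vp_of_ker ((resHom (f := fun x => f (g⁻¹ * x * g)) homg).comp (Subgroup.subtype _))
  refine vp_of_injective hCv
    (((MulAut.conj g⁻¹).toMonoidHom.comp (H0.subtype.comp
      ((Subgroup.subtype _).comp (Subgroup.subtype _)))).codRestrict C ?_) ?_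
  · intro x
    have h1 : f ((x : _) : G) = 0 := x.1.2
    have h2 : f (g⁻¹ * ((x : _) : G) * g) = 0 := x.2
    simpa using key _ x.1.1.2 h1 h2
  · intro x y hxy
    have h1 := (MulAut.conj g⁻¹).injective (congrArg Subtype.val hxy)
    exact Subtype.ext (Subtype.ext (Subtype.ext h1))

theorem two_homs {G : Type u} [Group G] (K : Subgroup G) (a b : G → ℤ)
    (ha : ∀ x ∈ K, ∀ y ∈ K, a (x * y) = a x + a y) (hb : ∀ x ∈ K, ∀ y ∈ K, b (x * y) = b x + b y)
    (hne : ∃ s ∈ K, 0 < a s) (hab : ∀ x ∈ K, ∃ y ∈ K, b y = a x) (hba : ∀ x ∈ K, ∃ y ∈ K, a y = b x) :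
    (∃ s ∈ K, 0 < a s ∧ b s ≤ 0) ∨ ∀ x ∈ K, b x = a x := by
  by_cases h : ∃ s ∈ K, 0 < a s ∧ b s ≤ 0
  · exact Or.inl h
  right
  push Not at h
  -- minimal positive
  have hex : ∃ n : ℕ, 0 < n ∧ ∃ s ∈ K, a s = n := by
    obtain ⟨s, hs, hp⟩ := hne
    exact ⟨(a s).toNat, by omega, s, hs, by omega⟩
  classical
  obtain ⟨hp, s0, hs0, has0⟩ := Nat.find_spec hex
  have hmin : ∀ s ∈ K, 0 < a s → (Nat.find hex : ℤ) ≤ a s := by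
    intro s hs hpos
    have := Nat.find_min' hex (m := (a s).toNat) ⟨by omega, s, hs, by omega⟩
    omega
  generalize Nat.find hex = p at *
  have hker : ∀ x ∈ K, a x = 0 → b x = 0 := by
    intro x hx h0
    have key : ∀ m : ℤ, 0 < b s0 + m * b x := by
      intro m
      have hm := K.zpow_mem hx m
      have := h (s0 * x ^ m) (K.mul_mem hs0 hm) (by
        rw [ha _ hs0 _ hm, hom_zpow ha hx, h0]; omega)
      rwa [hb _ hs0 _ hm, hom_zpow hb hx] at this
    have h1 := key (b s0 * b x * -1)
    by_contra hne
    have h2 : 1 ≤ b x * b x := by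
      have : 0 < b x * b x := mul_self_pos.2 hne
      omega
    have h3 := h s0 hs0 (by omega)
    nlinarith
  have hprop : ∀ x ∈ K, a s0 * b x = a x * b s0 := by
    intro x hx
    have h1 := K.zpow_mem hx (a s0)
    have h2 := K.zpow_mem hs0 (- a x)
    have := hker (x ^ (a s0) * s0 ^ (- a x)) (K.mul_mem h1 h2) (by
      rw [ha _ h1 _ h2, hom_zpow ha hx, hom_zpow ha hs0]; ring)
    rw [hb _ h1 _ h2, hom_zpow hb hx, hom_zpow hb hs0] at this
    linarith
  have hq := h s0 hs0 (by omega)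
  have heq : b s0 = a s0 := by
    obtain ⟨y, hy, hy'⟩ := hba s0 hs0
    have h1 := hmin y hy (by omega)
    obtain ⟨z, hz, hz'⟩ := hab s0 hs0
    have h2 := hprop z hz
    have h3 : 0 < a z := by
      rw [hz'] at h2
      have : 0 < a s0 * a s0 := mul_self_pos.2 (by omega)
      rw [h2] at this
      by_contra hneg
      nlinarith
    have h4 := hmin z hz h3
    rw [hz'] at h2
    nlinarith
  intro x hx
  have := hprop x hx
  rw [heq, mul_comm] at this
  exact mul_right_cancel₀ (by omega) this

theorem vp_locally {G : Type u} [Group G] {H : Subgroup G} {f : G → ℤ} {B : Subgroup G} {t : G}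
    (D : AscData H f B t) (H0 : Subgroup G) (hfi : H0.FiniteIndex) (hle : H0 ≤ H)
    (L : Subgroup G) (hL : L.FG) (hLf : ∀ x ∈ L, x ∈ H0 → f x = 0) : IsVirtuallyPolycyclic L := by
  have h1 : Group.FG L := (Group.fg_iff_subgroup_fg L).2 hL
  have h2 : Group.FG (H0.subgroupOf L) := inferInstance
  have h3 : ((H0.subgroupOf L).map L.subtype).FG := by
    rw [← Group.fg_iff_subgroup_fg]
    exact Group.fg_of_surjective
      ((H0.subgroupOf L).equivMapOfInjective L.subtype L.subtype_injective).surjective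
      (f := ((H0.subgroupOf L).equivMapOfInjective L.subtype L.subtype_injective).toMonoidHom)
  have hm : ∀ x ∈ (H0.subgroupOf L).map L.subtype, x ∈ L ∧ x ∈ H0 := by
    rintro _ ⟨x, hx, rfl⟩
    exact ⟨x.2, hx⟩
  obtain ⟨C, hCv, -, -, hLC, -, -⟩ := D.rebase _ (fun x hx => hle (hm x hx).2)
    (fun x hx => hLf x (hm x hx).1 (hm x hx).2) h3 t D.tH (by rw [D.tf]; norm_num)
  refine vp_of_finiteIndex (H0.subgroupOf L) inferInstance ?_
  refine vp_of_injective hCv ((L.subtype.comp (Subgroup.subtype _)).codRestrict C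
    (fun x => hLC ⟨x, x.2, rfl⟩)) ?_
  intro x y hxy
  have h5 : ((x : L) : G) = ((y : L) : G) := congrArg (Subtype.val : C → G) hxy
  exact Subtype.ext (Subtype.ext h5)

theorem fg_map {G : Type u} [Group G] {B : Subgroup G} (h : B.FG) (e : G →* G) : (B.map e).FG := by
  obtain ⟨S, hS⟩ := h
  classical
  refine ⟨S.image e, ?_⟩
  rw [← hS, MonoidHom.map_closure]; simp

theorem final_step {G : Type u} [Group G] {H : Subgroup G} {f : G → ℤ} {B : Subgroup G} {t : G}
    (D : AscData H f B t) (H0 : Subgroup G) (hn : H0.Normal) (hfi : H0.FiniteIndex) (hle : H0 ≤ H)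
    (ψ : G →* Multiplicative ℤ)
    (hψ : ∀ h ∈ H0, ∃ c : ℤ, 0 < c ∧ (ψ h).toAdd = c * f h) :
    ∃ (B' : Subgroup G) (t' : G), IsAscendingHNN G B' t' ∧ IsVirtuallyPolycyclic B' := by
  have hker : ∀ x ∈ H0, (ψ x = 1 ↔ f x = 0) := by
    intro x hx
    obtain ⟨c, hc, h⟩ := hψ x hx
    constructor
    · intro h1
      rw [h1, toAdd_one] at h
      rcases mul_eq_zero.1 h.symm with h2 | h2
      · omega
      · exact h2
    · intro h1
      rw [h1, mul_zero] at h
      exact Multiplicative.toAdd.injective h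
  -- generator
  obtain ⟨s, hs, hspos⟩ : ∃ s : G, (∀ g : G, ∃ i : ℤ, ψ g = ψ s ^ i) ∧ 0 < (ψ s).toAdd := by
    have hcyc : IsCyclic ψ.range := inferInstance
    obtain ⟨⟨_, s, rfl⟩, hs⟩ := hcyc.exists_generator
    have hs' : ∀ g : G, ∃ i : ℤ, ψ g = ψ s ^ i := by
      intro g
      obtain ⟨i, hi⟩ := hs ⟨ψ g, g, rfl⟩
      exact ⟨i, (congrArg Subtype.val hi).symm⟩
    have hne : (ψ s).toAdd ≠ 0 := by
      intro h0
      have h1 : ψ s = 1 := Multiplicative.toAdd.injective h0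
      obtain ⟨n, hn0, -, hn⟩ := Subgroup.exists_pow_mem_of_index_ne_zero hfi.index_ne_zero t
      have h2 := hom_pow D.hom D.tH n
      rw [D.tf] at h2
      have h3 := (hker _ hn).1 (by obtain ⟨i, hi⟩ := hs' (t ^ n); rw [hi, h1, one_zpow])
      omega
    rcases lt_or_gt_of_ne hne with h | h
    · refine ⟨s⁻¹, fun g => ?_, ?_⟩
      · obtain ⟨i, hi⟩ := hs' g
        exact ⟨-i, by rw [hi, map_inv, inv_zpow', neg_neg]⟩
      · rw [map_inv, toAdd_inv]; omega
    · exact ⟨s, hs', h⟩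
  obtain ⟨k, hk0, -, hk⟩ := Subgroup.exists_pow_mem_of_index_ne_zero hfi.index_ne_zero s
  obtain ⟨r, hr⟩ : ∃ r, r = s ^ k := ⟨_, rfl⟩
  rw [← hr] at hk
  have hfr : 0 < f r := by
    obtain ⟨c, hc, h⟩ := hψ r hk
    have : 0 < c * f r := by
      rw [← h, hr, map_pow, Int.toAdd_pow]; positivity
    by_contra hneg
    nlinarith
  have hKn : ψ.ker.Normal := inferInstance
  let K := ψ.ker
  have hKconj : ∀ g, ∀ x ∈ K, g * x * g⁻¹ ∈ K := fun g x hx => hKn.conj_mem x hx g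
  let Q := K ⧸ (H0.subgroupOf K)
  have : Finite Q := Subgroup.finite_quotient_of_finiteIndex
  let ρ : Q → G := fun q => (Quotient.out q : K)
  have hρK : ∀ q, ρ q ∈ K := fun q => (Quotient.out q : K).2
  have hρ : ∀ x ∈ K, ∃ q, (ρ q)⁻¹ * x ∈ H0 := by
    intro x hx
    refine ⟨(QuotientGroup.mk ⟨x, hx⟩ : Q), ?_⟩
    have h3 : (QuotientGroup.mk (Quotient.out (QuotientGroup.mk ⟨x, hx⟩ : Q)) : Q)
      = QuotientGroup.mk ⟨x, hx⟩ := QuotientGroup.out_eq' _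
    rw [QuotientGroup.eq] at h3
    exact h3
  have : ∀ q, ∃ q', (ρ q')⁻¹ * (r * ρ q * r⁻¹) ∈ H0 := fun q => hρ _ (hKconj r _ (hρK q))
  choose σ hσ using this
  let ν : Q → G := fun q => (ρ (σ q))⁻¹ * (r * ρ q * r⁻¹)
  have hνK : ∀ q, ν q ∈ K := fun q => K.mul_mem (K.inv_mem (hρK _)) (hKconj r _ (hρK q))
  have hL0le : Subgroup.closure (Set.range ν) ≤ K ⊓ H0 := by
    rw [Subgroup.closure_le]
    rintro _ ⟨q, rfl⟩
    exact ⟨hνK q, hσ q⟩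
  have fgr : ∀ u : Q → G, (Subgroup.closure (Set.range u)).FG := fun u =>
    ⟨(Set.finite_range u).toFinset, by simp⟩
  obtain ⟨C, hCv, hCH, hCf, hLC, hCr, hCa⟩ := D.rebase (Subgroup.closure (Set.range ν))
    (fun x hx => hle (hL0le hx).2) (fun x hx => (hker x (hL0le hx).2).1 (hL0le hx).1) (fgr ν)
    r (hle hk) hfr.le
  have hCa := hCa hfr
  let L' := (C ⊓ H0) ⊔ Subgroup.closure (Set.range ρ)
  have hL'fg : L'.FG :=
    ((Group.fg_iff_subgroup_fg _).1 (vp_fg (vp_mono inf_le_left hCv))).sup (fgr ρ)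
  have hρL' : ∀ q, ρ q ∈ L' := fun q => Subgroup.mem_sup_right (Subgroup.subset_closure ⟨q, rfl⟩)
  have hL'K : L' ≤ K := by
    refine sup_le ?_ ?_
    · rintro x ⟨h1, h2⟩
      exact (hker x h2).2 (hCf x h1)
    · rw [Subgroup.closure_le]
      rintro _ ⟨q, rfl⟩
      exact hρK q
  have hL'r : L' ≤ L'.comap (MulAut.conj r).toMonoidHom := by
    refine sup_le ?_ ?_
    · rintro x ⟨h1, h2⟩
      exact Subgroup.mem_sup_left ⟨hCr x h1, hn.conj_mem x h2 r⟩
    · rw [Subgroup.closure_le]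
      rintro _ ⟨q, rfl⟩
      change r * ρ q * r⁻¹ ∈ L'
      have h1 : ν q ∈ L' := Subgroup.mem_sup_left ⟨hLC (Subgroup.subset_closure ⟨q, rfl⟩), hσ q⟩
      have := L'.mul_mem (hρL' (σ q)) h1
      simpa [ν] using this
  let L : Subgroup G := ⨆ i : Fin k, L'.map (MulAut.conj (s ^ (i : ℕ))).toMonoidHom
  have hLfg : L.FG := Subgroup.FG.iSup _ (fun i => fg_map hL'fg _)
  have hLm : ∀ i < k, ∀ x ∈ L', s ^ i * x * (s ^ i)⁻¹ ∈ L := by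
    intro i hi x hx
    exact Subgroup.mem_iSup_of_mem (⟨i, hi⟩ : Fin k) ⟨x, hx, rfl⟩
  have hL'L : L' ≤ L := fun x hx => by simpa using hLm 0 hk0 x hx
  have hLK : L ≤ K := by
    refine iSup_le fun i => ?_
    rintro _ ⟨x, hx, rfl⟩
    exact hKconj _ _ (hL'K hx)
  have hLs : L ≤ L.comap (MulAut.conj s).toMonoidHom := by
    refine iSup_le fun i => ?_
    rintro _ ⟨x, hx, rfl⟩
    change s * (s ^ (i : ℕ) * x * (s ^ (i : ℕ))⁻¹) * s⁻¹ ∈ L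
    have e : s * (s ^ (i : ℕ) * x * (s ^ (i : ℕ))⁻¹) * s⁻¹
        = s ^ ((i : ℕ) + 1) * x * (s ^ ((i : ℕ) + 1))⁻¹ := by
      rw [pow_succ']; simp [mul_assoc]
    rw [e]
    rcases Nat.lt_or_ge ((i : ℕ) + 1) k with h | h
    · exact hLm _ h x hx
    · have : (i : ℕ) + 1 = k := by omega
      rw [this, ← hr]
      exact hL'L (hL'r hx)
  refine ⟨L, s, ⟨?_, fun b hb => hLs hb⟩, ?_⟩
  · rw [eq_top_iff]
    let T := Subgroup.closure ((L : Set G) ∪ {s})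
    have hLT : L ≤ T := fun x hx => Subgroup.subset_closure (Or.inl hx)
    have hsT : s ∈ T := Subgroup.subset_closure (Or.inr rfl)
    have hrT : r ∈ T := hr ▸ T.pow_mem hsT k
    have hN : ∀ x ∈ K, x ∈ H0 → x ∈ T := by
      intro x h1 h2
      obtain ⟨j, hj⟩ := hCa x (hle h2) ((hker x h2).1 h1)
      have h3 : r ^ j * x * (r ^ j)⁻¹ ∈ T :=
        hLT (hL'L (Subgroup.mem_sup_left ⟨hj, hn.conj_mem x h2 _⟩))
      have hrj := T.pow_mem hrT j
      have := T.mul_mem (T.mul_mem (T.inv_mem hrj) h3) hrj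
      simpa [mul_assoc] using this
    have hK : ∀ x ∈ K, x ∈ T := by
      intro x hx
      obtain ⟨q, hq⟩ := hρ x hx
      have h1 := hN _ (K.mul_mem (K.inv_mem (hρK q)) hx) hq
      have := T.mul_mem (hLT (hL'L (hρL' q))) h1
      simpa using this
    intro g _
    obtain ⟨i, hi⟩ := hs g
    have h1 : g * (s ^ i)⁻¹ ∈ K := by
      change ψ _ = 1
      simp [hi]
    have := T.mul_mem (hK _ h1) (T.zpow_mem hsT i)
    rw [inv_mul_cancel_right] at this
    exact this
  · exact vp_locally D H0 hfi hle L hLfg (fun x h1 h2 => (hker x h2).1 (hLK h1))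

theorem transfer_pos {G : Type u} [Group G] {H : Subgroup G} {f : G → ℤ} [hH : H.FiniteIndex]
    (hom : ∀ x ∈ H, ∀ y ∈ H, f (x * y) = f x + f y)
    (H0 : Subgroup G) (hn : H0.Normal) (hle : H0 ≤ H)
    (hinv : ∀ g, ∀ x ∈ H0, f (g⁻¹ * x * g) = f x) (h : G) (hh : h ∈ H0) :
    ∃ c : ℤ, 0 < c ∧ ((MonoidHom.transfer (resHom hom)) h).toAdd = c * f h := by
  have : Finite (G ⧸ H) := Subgroup.finite_quotient_of_finiteIndex
  have : Finite (Quotient (MulAction.orbitRel (Subgroup.zpowers h) (G ⧸ H))) := Quotient.finite _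
  let _ := Fintype.ofFinite (Quotient (MulAction.orbitRel (Subgroup.zpowers h) (G ⧸ H)))
  have hne : Nonempty (Quotient (MulAction.orbitRel (Subgroup.zpowers h) (G ⧸ H))) :=
    ⟨Quotient.mk _ ((1 : G) : G ⧸ H)⟩
  refine ⟨∑ q : Quotient (MulAction.orbitRel (Subgroup.zpowers h) (G ⧸ H)),
    (Function.minimalPeriod (h • ·) q.out : ℤ), ?_, ?_⟩
  · refine Finset.sum_pos ?_ Finset.univ_nonempty
    intro q _
    have : 0 < Function.minimalPeriod (h • ·) q.out := by
      apply Function.minimalPeriod_pos_of_mem_periodicPts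
      exact (MulAction.injective h).mem_periodicPts _
    exact_mod_cast this
  · rw [MonoidHom.transfer_eq_prod_quotient_orbitRel_zpowers_quot, toAdd_prod, Finset.sum_mul]
    refine Finset.sum_congr rfl fun q _ => ?_
    change f (_⁻¹ * _ * _) = _
    rw [hinv _ _ (H0.pow_mem hh _), hom_pow hom (hle hh)]

theorem exists_hom {H : Type u} [Group H] (B : Subgroup H) (t : H) (hHNN : IsAscendingHNN H B t)
    (hB : IsVirtuallyPolycyclic B) :
    IsVirtuallyPolycyclic H ∨ ∃ φ : H →* Multiplicative ℤ, φ t = Multiplicative.ofAdd 1 ∧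
      ∀ x, φ x = 1 ↔ ∃ j : ℕ, t ^ j * x * (t ^ j)⁻¹ ∈ B := by
  obtain ⟨hgen, htB⟩ := hHNN
  have mono : ∀ i j : ℕ, i ≤ j → ∀ x, t ^ i * x * (t ^ i)⁻¹ ∈ B → t ^ j * x * (t ^ j)⁻¹ ∈ B := by
    intro i j hij x hx
    obtain ⟨d, rfl⟩ := Nat.exists_eq_add_of_le hij
    have := conj_pow_mem htB d _ hx
    rw [add_comm, pow_add]
    simpa [mul_assoc] using this
  let N : Subgroup H :=
    { carrier := {x | ∃ j : ℕ, t ^ j * x * (t ^ j)⁻¹ ∈ B}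
      one_mem' := ⟨0, by simp [B.one_mem]⟩
      mul_mem' := by
        rintro x y ⟨i, hi⟩ ⟨j, hj⟩
        refine ⟨max i j, ?_⟩
        have := B.mul_mem (mono _ _ (le_max_left i j) _ hi) (mono _ _ (le_max_right i j) _ hj)
        simpa [mul_assoc] using this
      inv_mem' := by
        rintro x ⟨i, hi⟩
        refine ⟨i, ?_⟩
        have := B.inv_mem hi
        simpa [mul_assoc] using this }
  have memN : ∀ x, x ∈ N ↔ ∃ j : ℕ, t ^ j * x * (t ^ j)⁻¹ ∈ B := fun x => Iff.rfl
  have hBN : B ≤ N := fun b hb => ⟨0, by simpa using hb⟩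
  have hNn : N.Normal := by
    rw [← Subgroup.normalizer_eq_top_iff, eq_top_iff, ← hgen, Subgroup.closure_le]
    rintro x (hx | hx)
    · exact Subgroup.le_normalizer (hBN hx)
    · rw [Set.mem_singleton_iff] at hx
      subst hx
      rw [SetLike.mem_coe, Subgroup.mem_normalizer_iff]
      intro y
      have e : ∀ j : ℕ, x ^ j * (x * y * x⁻¹) * (x ^ j)⁻¹ = x ^ (j + 1) * y * (x ^ (j + 1))⁻¹ := by
        intro j; rw [pow_succ]; simp [mul_assoc]
      constructor
      · rintro ⟨j, hj⟩
        exact ⟨j, by rw [e]; exact mono _ _ (Nat.le_succ j) _ hj⟩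
      · rintro ⟨j, hj⟩
        exact ⟨j + 1, by rw [← e]; exact hj⟩
  have htop : Subgroup.zpowers (QuotientGroup.mk t : H ⧸ N) = ⊤ := by
    have h1 : (Subgroup.zpowers (QuotientGroup.mk t : H ⧸ N)).comap (QuotientGroup.mk' N) = ⊤ := by
      rw [eq_top_iff, ← hgen, Subgroup.closure_le]
      rintro x (hx | hx)
      · have : (QuotientGroup.mk x : H ⧸ N) = 1 := (QuotientGroup.eq_one_iff x).2 (hBN hx)
        change (QuotientGroup.mk x : H ⧸ N) ∈ Subgroup.zpowers (QuotientGroup.mk t : H ⧸ N)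
        rw [this]; exact one_mem _
      · rw [Set.mem_singleton_iff] at hx
        subst hx
        exact Subgroup.mem_zpowers _
    rw [eq_top_iff]
    intro y _
    obtain ⟨x, rfl⟩ := QuotientGroup.mk_surjective y
    have : x ∈ (⊤ : Subgroup H) := trivial
    rw [← h1] at this
    exact this
  rcases finite_or_infinite (H ⧸ N) with hfin | hinf
  · left
    have hNB : N ≤ B := by
      obtain ⟨k, hk, hk'⟩ := isOfFinOrder_iff_pow_eq_one.1
        (isOfFinOrder_of_finite (QuotientGroup.mk t : H ⧸ N))
      rw [← QuotientGroup.mk_pow, QuotientGroup.eq_one_iff] at hk'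
      obtain ⟨j, hj⟩ := hk'
      have htk : t ^ k ∈ B := by
        rw [← pow_add, add_comm, pow_add] at hj
        simpa using hj
      rintro x ⟨i, hi⟩
      have h1 := mono i (k * i) (Nat.le_mul_of_pos_left i hk) x hi
      have h2 : t ^ (k * i) ∈ B := by rw [pow_mul]; exact B.pow_mem htk i
      have := B.mul_mem (B.mul_mem (B.inv_mem h2) h1) h2
      simpa [mul_assoc] using this
    exact vp_of_finiteIndex N Subgroup.finiteIndex_of_finite_quotient (vp_mono hNB hB)
  · right
    have hg : ∀ x : H ⧸ N, x ∈ Subgroup.zpowers (QuotientGroup.mk t : H ⧸ N) := by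
      intro x; rw [htop]; trivial
    let e : Multiplicative ℤ →* H ⧸ N := zpowersHom _ (QuotientGroup.mk t : H ⧸ N)
    have he : Function.Bijective e := by
      constructor
      · intro a b hab
        have h0 : ¬ IsOfFinOrder (QuotientGroup.mk t : H ⧸ N) := by
          intro h
          have h2 := h.finite_zpowers
          rw [htop] at h2
          have : Finite (H ⧸ N) := Set.finite_univ_iff.1 (by simpa using h2)
          exact not_finite (H ⧸ N)
        exact Multiplicative.toAdd.injective (injective_zpow_iff_not_isOfFinOrder.2 h0 hab)
      · intro x
        obtain ⟨i, hi⟩ := hg x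
        exact ⟨Multiplicative.ofAdd i, hi⟩
    let E := MulEquiv.ofBijective e he
    refine ⟨E.symm.toMonoidHom.comp (QuotientGroup.mk' N), ?_, ?_⟩
    · change E.symm (QuotientGroup.mk t) = _
      rw [MulEquiv.symm_apply_eq]
      change _ = e _
      simp [e]
    · intro x
      rw [← memN, ← QuotientGroup.eq_one_iff]
      change E.symm (QuotientGroup.mk x) = 1 ↔ _
      rw [MulEquiv.symm_apply_eq, map_one]

/-- If a group `G` has a finite-index subgroup `H` which is an ascending HNN extension with
virtually polycyclic vertex group, then `G` itself is virtually polycyclic or `G` is an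
ascending HNN extension with virtually polycyclic vertex group. -/
theorem virtuallyPolycyclic_or_ascendingHNN_of_finiteIndex (G : Type u) [Group G]
    (H : Subgroup G) (hH : H.FiniteIndex)
    (B : Subgroup H) (t : H) (hHNN : IsAscendingHNN H B t)
    (hB : IsVirtuallyPolycyclic B) :
    IsVirtuallyPolycyclic G ∨
      ∃ (B' : Subgroup G) (t' : G), IsAscendingHNN G B' t' ∧ IsVirtuallyPolycyclic B' := by
  by_cases hG : IsVirtuallyPolycyclic G
  · exact Or.inl hG
  right
  rcases exists_hom B t hHNN hB with hv | ⟨φ, hφt, hφ⟩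
  · exact absurd (vp_of_finiteIndex H hH hv) hG
  classical
  let f : G → ℤ := fun x => if h : x ∈ H then (φ ⟨x, h⟩).toAdd else 0
  have hf : ∀ x (h : x ∈ H), f x = (φ ⟨x, h⟩).toAdd := fun x h => dif_pos h
  have hf0 : ∀ x (h : x ∈ H), f x = 0 ↔ φ ⟨x, h⟩ = 1 := by
    intro x h
    rw [hf x h]; exact Iff.rfl
  have D : AscData H f (B.map H.subtype) (t : G) := by
    refine ⟨?_, ?_, ?_, t.2, ?_, ?_, ?_, ?_⟩
    · intro x hx y hy
      rw [hf _ hx, hf _ hy, hf _ (H.mul_mem hx hy), ← toAdd_mul, ← map_mul]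
      rfl
    · rintro _ ⟨x, hx, rfl⟩
      exact x.2
    · rintro _ ⟨x, hx, rfl⟩
      refine (hf0 _ x.2).2 ((hφ x).2 ⟨0, by simpa using hx⟩)
    · rw [hf _ t.2]
      change (φ t).toAdd = 1
      rw [hφt]; rfl
    · rintro _ ⟨x, hx, rfl⟩
      exact ⟨_, hHNN.2 x hx, by simp⟩
    · intro x hx h0
      obtain ⟨j, hj⟩ := (hφ ⟨x, hx⟩).1 ((hf0 x hx).1 h0)
      exact ⟨j, _, hj, by simp⟩
    · let e := B.equivMapOfInjective H.subtype H.subtype_injective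
      exact vp_of_injective hB e.symm.toMonoidHom e.symm.injective
  let H0 := H.normalCore
  have hle : H0 ≤ H := H.normalCore_le
  have hn : H0.Normal := inferInstance
  have hfi : H0.FiniteIndex := inferInstance
  have cj : ∀ g, ∀ x ∈ H0, g⁻¹ * x * g ∈ H0 := fun g x hx => by simpa using hn.conj_mem x hx g⁻¹
  have hinv : ∀ g, ∀ x ∈ H0, f (g⁻¹ * x * g) = f x := by
    intro g
    rcases two_homs H0 f (fun x => f (g⁻¹ * x * g))
      (fun x hx y hy => D.hom x (hle hx) y (hle hy))
      (fun x hx y hy => by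
        rw [← D.hom _ (hle (cj g x hx)) _ (hle (cj g y hy))]; congr 1; group)
      (by
        obtain ⟨n, hn0, -, hn⟩ := Subgroup.exists_pow_mem_of_index_ne_zero hfi.index_ne_zero (t : G)
        refine ⟨_, hn, ?_⟩
        rw [hom_pow D.hom D.tH, D.tf]; omega)
      (fun x hx => ⟨g * x * g⁻¹, hn.conj_mem x hx g, by congr 1; group⟩)
      (fun x hx => ⟨g⁻¹ * x * g, cj g x hx, rfl⟩) with ⟨s, hs, h1, h2⟩ | h
    · exact absurd (vp_of_finiteIndex H0 hfi (D.vp_of_neg H0 hn hle g s hs h1 h2)) hG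
    · exact h
  exact final_step D H0 hn hfi hle (MonoidHom.transfer (resHom D.hom))
    (fun h hh => transfer_pos D.hom H0 hn hle hinv h hh)
end

section
/- Every finite-index subgroup of an ascending HNN extension with virtually polycyclic vertex group is itself an ascending HNN extension with virtually polycyclic vertex group. -/
universe u v

theorem IsPolycyclic.of_injective_aux (G : Type u) [Group G] (hG : IsPolycyclic G) :
    ∀ (H : Type u) [Group H] (f : H →* G), Function.Injective f → IsPolycyclic H := by
  induction hG with
  | of_subsingleton G h =>
    intro H _ f hf
    exact IsPolycyclic.of_subsingleton H hf.subsingleton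
  | step G N hN h1 h2 ih =>
    intro H _ f hf
    refine IsPolycyclic.step H (N.comap f) inferInstance ?_ ?_
    · refine ih _ (f.subgroupComap N) ?_
      intro x y hxy
      apply Subtype.ext
      apply hf
      exact congrArg Subtype.val hxy
    · refine isCyclic_of_injective (QuotientGroup.map (N.comap f) N f le_rfl) ?_
      rw [injective_iff_map_eq_one]
      intro a
      induction a using QuotientGroup.induction_on with
      | H z =>
        intro hz
        rw [QuotientGroup.map_mk, QuotientGroup.eq_one_iff] at hz
        exact (QuotientGroup.eq_one_iff z).2 hz

theorem IsVirtuallyPolycyclic.of_injective_aux {G H : Type u} [Group G] [Group H]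
    (hG : IsVirtuallyPolycyclic G) (f : H →* G) (hf : Function.Injective f) :
    IsVirtuallyPolycyclic H := by
  obtain ⟨P, hP, hPP⟩ := hG
  refine ⟨P.comap f, ⟨?_⟩, ?_⟩
  · rw [Subgroup.index_comap]
    exact fun h0 => hP.index_ne_zero (by simpa using Subgroup.relIndex_eq_zero_of_le_right (le_top : f.range ≤ ⊤) h0)
  refine hPP.of_injective_aux _ _ (f.subgroupComap P) ?_
  intro x y hxy
  apply Subtype.ext
  apply hf
  exact congrArg Subtype.val hxy

def auxConj {G : Type u} [Group G] (B : Subgroup G) (t : G) (j : ℕ) : Subgroup G :=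
  B.comap (MulAut.conj (t ^ j)).toMonoidHom

theorem mem_auxConj {G : Type u} [Group G] (B : Subgroup G) (t : G) (j : ℕ) (g : G) :
    g ∈ auxConj B t j ↔ t ^ j * g * (t ^ j)⁻¹ ∈ B := Iff.rfl

theorem mem_auxConj_add {G : Type u} [Group G] (B : Subgroup G) (t : G) (j m : ℕ) (g : G) :
    g ∈ auxConj B t (j + m) ↔ t ^ m * g * (t ^ m)⁻¹ ∈ auxConj B t j := by
  rw [mem_auxConj, mem_auxConj, pow_add]
  simp [mul_assoc]

theorem auxConj_mono {G : Type u} [Group G] (B : Subgroup G) (t : G)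
    (h : ∀ b ∈ B, t * b * t⁻¹ ∈ B) : Monotone (auxConj B t) := by
  apply monotone_nat_of_le_succ
  intro n g hg
  rw [mem_auxConj] at hg ⊢
  have := h _ hg
  rw [pow_succ']
  simpa [mul_assoc] using this

theorem ascendingHNN_of_finiteIndex_subgroup (G : Type u) [Group G]
    (B : Subgroup G) (t : G) (hHNN : IsAscendingHNN G B t)
    (hB : IsVirtuallyPolycyclic B)
    (K : Subgroup G) (hK : K.FiniteIndex) :
    ∃ (B' : Subgroup K) (t' : K), IsAscendingHNN K B' t' ∧ IsVirtuallyPolycyclic B' := by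
  obtain ⟨hgen, hasc⟩ := hHNN
  have hmono := auxConj_mono B t hasc
  let N : Subgroup G := ⨆ j, auxConj B t j
  have memN : ∀ g, g ∈ N ↔ ∃ j, g ∈ auxConj B t j := fun g =>
    Subgroup.mem_iSup_of_directed hmono.directed_le
  have hBN : B ≤ N := fun b hb => (memN b).2 ⟨0, by simpa [mem_auxConj] using hb⟩
  have hNn : N.Normal := by
    rw [← Subgroup.normalizer_eq_top_iff, eq_top_iff, ← hgen, Subgroup.closure_le]
    rintro x (hx | hx)
    · exact Subgroup.le_normalizer (hBN hx)
    · rw [Set.mem_singleton_iff] at hx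
      subst hx
      rw [SetLike.mem_coe, Subgroup.mem_normalizer_iff]
      intro g
      rw [memN, memN]
      constructor
      · rintro ⟨j, hj⟩
        refine ⟨j, ?_⟩
        have := (mem_auxConj_add B x j 1 g).1 (hmono (Nat.le_succ j) hj)
        simpa using this
      · rintro ⟨j, hj⟩
        refine ⟨j + 1, (mem_auxConj_add B x j 1 g).2 ?_⟩
        simpa using hj
  let π := QuotientGroup.mk' N
  have hπ : ∀ g, π g = 1 ↔ g ∈ N := fun g => QuotientGroup.eq_one_iff g
  have hz : ∀ g, ∃ z : ℤ, π t ^ z = π g := by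
    have : (⊤ : Subgroup G) ≤ (Subgroup.zpowers (π t)).comap π := by
      rw [← hgen, Subgroup.closure_le]
      rintro x (hx | hx)
      · change π x ∈ Subgroup.zpowers (π t)
        rw [(hπ x).2 (hBN hx)]
        exact one_mem _
      · rw [Set.mem_singleton_iff] at hx
        subst hx
        exact Subgroup.mem_zpowers _
    intro g
    exact this (Subgroup.mem_top g)
  let A : AddSubgroup ℤ :=
    { carrier := {z | π t ^ z ∈ K.map π}
      zero_mem' := by
        rw [Set.mem_ofPred_eq, zpow_zero]
        exact one_mem _
      add_mem' := by
        intro a b ha hb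
        rw [Set.mem_ofPred_eq, zpow_add]
        exact mul_mem ha hb
      neg_mem' := by
        intro a ha
        rw [Set.mem_ofPred_eq, zpow_neg]
        exact inv_mem ha }
  have memA : ∀ z, z ∈ A ↔ π t ^ z ∈ K.map π := fun z => Iff.rfl
  obtain ⟨m, hm0, hmA, hmdvd⟩ : ∃ m : ℕ, 0 < m ∧ (m : ℤ) ∈ A ∧ ∀ z ∈ A, (m : ℤ) ∣ z := by
    obtain ⟨a, ha⟩ := Int.subgroup_cyclic A
    rw [← AddSubgroup.zmultiples_eq_closure] at ha
    obtain ⟨r, hr0, -, hr⟩ := Subgroup.exists_pow_mem_of_index_ne_zero hK.index_ne_zero t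
    have hrA : (r : ℤ) ∈ A := by
      rw [memA, zpow_natCast, ← map_pow]
      exact Subgroup.mem_map_of_mem _ hr
    have hd : ∀ z ∈ A, a ∣ z := fun z hz => by
      rw [ha, Int.mem_zmultiples_iff] at hz
      exact hz
    refine ⟨a.natAbs, ?_, ?_, ?_⟩
    · rw [Int.natAbs_pos]
      rintro rfl
      have := hd _ hrA
      simp at this
      omega
    · rw [ha, Int.mem_zmultiples_iff]
      exact Int.dvd_natAbs_self
    · intro z hz
      exact Int.natAbs_dvd.2 (hd z hz)
  obtain ⟨k, hkK, hk⟩ := (memA _).1 hmA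
  rw [zpow_natCast] at hk
  have hn : k * (t ^ m)⁻¹ ∈ N := by
    rw [← hπ, map_mul, map_inv, map_pow, hk, mul_inv_cancel]
  obtain ⟨j, hj⟩ := (memN _).1 hn
  have hkconj : ∀ i, j ≤ i → ∀ y, y ∈ auxConj B t (i + m) → k * y * k⁻¹ ∈ auxConj B t i := by
    intro i hi y hy
    rw [mem_auxConj_add] at hy
    have h1 := hmono hi hj
    have := mul_mem (mul_mem h1 hy) (inv_mem h1)
    simpa [mul_assoc] using this
  have hkpow : ∀ i y, y ∈ auxConj B t (j + i * m) → k ^ i * y * (k ^ i)⁻¹ ∈ auxConj B t j := by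
    intro i
    induction i with
    | zero => intro y hy; simpa using hy
    | succ i ih =>
      intro y hy
      rw [Nat.succ_mul, ← add_assoc] at hy
      have := ih _ (hkconj _ (Nat.le_add_right _ _) _ hy)
      rw [pow_succ]
      simpa [mul_assoc] using this
  refine ⟨(auxConj B t j).subgroupOf K, ⟨k, hkK⟩, ⟨?_, ?_⟩, ?_⟩
  · set C := Subgroup.closure
      (((auxConj B t j).subgroupOf K : Set K) ∪ {(⟨k, hkK⟩ : K)}) with hC
    have hkC : (⟨k, hkK⟩ : K) ∈ C := Subgroup.subset_closure (Or.inr rfl)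
    have hNC : ∀ y : K, (y : G) ∈ N → y ∈ C := by
      intro y hy
      obtain ⟨l, hl⟩ := (memN _).1 hy
      have hl' : (y : G) ∈ auxConj B t (j + l * m) := hmono (by nlinarith) hl
      have h1 : (⟨k, hkK⟩ : K) ^ l * y * ((⟨k, hkK⟩ : K) ^ l)⁻¹ ∈ C := by
        refine Subgroup.subset_closure (Or.inl ?_)
        exact hkpow l y hl'
      have h2 := pow_mem hkC l
      have := mul_mem (mul_mem (inv_mem h2) h1) h2
      simpa [mul_assoc] using this
    rw [eq_top_iff]
    intro x _
    obtain ⟨z, hzx⟩ := hz x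
    have hzA : z ∈ A := by
      rw [memA, hzx]
      exact Subgroup.mem_map_of_mem _ x.2
    obtain ⟨q, rfl⟩ := hmdvd z hzA
    have h1 : x * ((⟨k, hkK⟩ : K) ^ q)⁻¹ ∈ C := by
      apply hNC
      rw [← hπ]
      simp only [Subgroup.coe_mul, Subgroup.coe_inv, Subgroup.coe_zpow, map_mul, map_inv, map_zpow]
      rw [← hzx, hk, zpow_mul, zpow_natCast, mul_inv_cancel]
    have := mul_mem h1 (zpow_mem hkC q)
    simpa using this
  · intro b hb
    exact hkconj j le_rfl b (hmono (Nat.le_add_right _ _) hb)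
  · let f : (auxConj B t j).subgroupOf K →* B :=
      (((MulAut.conj (t ^ j)).toMonoidHom.comp K.subtype).comp
        ((auxConj B t j).subgroupOf K).subtype).codRestrict B (fun x => x.2)
    refine hB.of_injective_aux f ?_
    intro x y hxy
    have h := congrArg Subtype.val hxy
    apply Subtype.ext
    apply Subtype.ext
    exact (MulAut.conj (t ^ j)).injective h
end

section
/- If G is an indicably coherent group containing no non-abelian free subgroup, then every quotient group of G is also indicably coherent. -/
universe u v

/-- `H` splits as an HNN extension with vertex group `V` realising the epimorphism
`φ : H → ℤ`: there are an edge subgroup `C` of `V`, an isomorphism `ψ` of `C` onto another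
subgroup `D` of `V`, and an isomorphism of the corresponding abstract HNN extension with `H`
restricting to the inclusion of `V`, such that `φ` coincides with the quotient map dividing
`H` by the normal closure of `V` (i.e. `φ` kills `V` and sends the stable letter to `1 ∈ ℤ`). -/
def SplitsAsHNNRealising (H : Type u) [Group H] (φ : H →* Multiplicative ℤ)
    (V : Subgroup H) : Prop :=
  ∃ (C D : Subgroup V) (ψ : C ≃* D) (e : HNNExtension V C D ψ ≃* H),
    (∀ v : V, e (HNNExtension.of v) = (v : H)) ∧
    (∀ v ∈ V, φ v = 1) ∧
    φ (e HNNExtension.t) = Multiplicative.ofAdd 1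
/-- A group `G` is indicably coherent if for every finitely generated subgroup `H ≤ G` and
every epimorphism `φ : H → ℤ`, the group `H` splits as an HNN extension with finitely
generated vertex group realising `φ`. -/
def IndicablyCoherent (G : Type u) [Group G] : Prop :=
  ∀ H : Subgroup G, Group.FG H → ∀ φ : H →* Multiplicative ℤ, Function.Surjective φ →
    ∃ A : Subgroup H, Group.FG A ∧ SplitsAsHNNRealising H φ A

open HNNExtension in
theorem aux_free {V : Type*} [Group V] {C D : Subgroup V} (ψ : C ≃* D)
    (a b : V) (ha : a ∉ C) (hb : b ∉ D) :
    ∃ f : FreeGroup (Fin 2) →* HNNExtension V C D ψ, Function.Injective f := by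
  let sg : Fin 2 × Bool → ℤˣ := fun p => if p.2 then 1 else -1
  let h : Fin 2 × Bool → V := fun p => if p.1 = 0 then 1 else if p.2 then b else a
  let r : Fin 2 × Bool → V := fun p => if p.1 = 0 then 1 else if p.2 then a⁻¹ else b⁻¹
  let hd : List (Fin 2 × Bool) → V := fun L => (L.head?.map h).getD 1
  let F : List (Fin 2 × Bool) → List (ℤˣ × V) := fun L =>
    List.rec [] (fun p L ih => (sg p, r p * hd L) :: ih) L
  let f : FreeGroup (Fin 2) →* HNNExtension V C D ψ :=
    FreeGroup.lift (fun i => if i = 0 then t else of b * t * (of a)⁻¹)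
  have hletter : ∀ p : Fin 2 × Bool, f (FreeGroup.mk [p]) =
      of (h p) * (t ^ (sg p : ℤ) * of (r p)) := by
    rintro ⟨i, c⟩
    fin_cases i <;> cases c <;> simp [f, h, r, sg, mul_assoc]
  have hprod : ∀ L, f (FreeGroup.mk L) =
      of (hd L) * ((F L).map (fun x => t ^ (x.1 : ℤ) * of x.2)).prod := by
    intro L
    induction L with
    | nil =>
      have : FreeGroup.mk ([] : List (Fin 2 × Bool)) = 1 := rfl
      simp [hd, F, this]
    | cons p L ih =>
      have h1 : FreeGroup.mk (p :: L) = FreeGroup.mk [p] * FreeGroup.mk L := by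
        simp
      rw [h1, map_mul, ih, hletter]
      simp [hd, F, mul_assoc]
  have hchain : ∀ L, FreeGroup.IsReduced L →
      (F L).IsChain (fun x y => x.2 ∈ toSubgroup C D x.1 → x.1 = y.1) := by
    intro L
    induction L with
    | nil => intro _; simp [F]
    | cons p L ih =>
      intro hL
      cases L with
      | nil => simp [F]
      | cons q L =>
        rw [FreeGroup.IsReduced, List.isChain_cons_cons] at hL
        have ih' := ih hL.2
        change List.IsChain _ (_ :: _ :: F L)
        rw [List.isChain_cons_cons]
        refine ⟨?_, ih'⟩
        have h1 := hL.1
        obtain ⟨i, c⟩ := p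
        obtain ⟨j, d⟩ := q
        clear ih ih' hL hprod hletter
        fin_cases i <;> fin_cases j <;> cases c <;> cases d <;>
          simp_all [sg, h, r, hd]
  refine ⟨f, (injective_iff_map_eq_one f).2 ?_⟩
  intro x hx
  let w : NormalWord.ReducedWord V C D :=
    { head := hd x.toWord, toList := F x.toWord, chain := hchain _ FreeGroup.isReduced_toWord }
  have hw : w.prod ψ = 1 := by
    rw [← hx, ← FreeGroup.mk_toWord (x := x), hprod]
    simp [NormalWord.ReducedWord.prod, w]
  have h2 := ReducedWord.toList_eq_nil_of_mem_of_range ψ w (by rw [hw]; exact one_mem _)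
  rw [← FreeGroup.toWord_eq_nil_iff]
  change F x.toWord = [] at h2
  cases hx' : x.toWord with
  | nil => rfl
  | cons p L => rw [hx'] at h2; simp [F] at h2

theorem aux_form {X : Type*} [Group X] (A : Subgroup X) (s : X)
    (hgen : ∀ K : Subgroup X, A ≤ K → s ∈ K → K = ⊤)
    (hs : ∀ a ∈ A, s * a * s⁻¹ ∈ A) (x : X) :
    ∃ n m : ℕ, ∃ a ∈ A, x = (s ^ n)⁻¹ * a * s ^ m := by
  have hs' : ∀ k : ℕ, ∀ a ∈ A, s ^ k * a * (s ^ k)⁻¹ ∈ A := by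
    intro k
    induction k with
    | zero => simp
    | succ k ih =>
      intro a ha
      have := hs _ (ih a ha)
      rw [pow_succ']
      convert this using 1
      group
  let K : Subgroup X :=
    { carrier := {x | ∃ n m : ℕ, ∃ a ∈ A, x = (s ^ n)⁻¹ * a * s ^ m}
      one_mem' := ⟨0, 0, 1, one_mem _, by simp⟩
      inv_mem' := by
        rintro _ ⟨n, m, a, ha, rfl⟩
        exact ⟨m, n, a⁻¹, inv_mem ha, by group⟩
      mul_mem' := by
        rintro _ _ ⟨n, m, a, ha, rfl⟩ ⟨n', m', a', ha', rfl⟩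
        refine ⟨n + n', m' + m, _, mul_mem (hs' n' _ ha) (hs' m _ ha'), ?_⟩
        have e1 : s ^ (n + n') = s ^ n' * s ^ n := by rw [add_comm, pow_add]
        have e2 : s ^ (m' + m) = s ^ m * s ^ m' := by rw [add_comm, pow_add]
        have e3 : s ^ m * (s ^ n')⁻¹ = (s ^ n')⁻¹ * s ^ m := by group
        rw [e1, e2]
        calc _ = (s ^ n)⁻¹ * a * (s ^ m * (s ^ n')⁻¹) * a' * s ^ m' := by group
          _ = _ := by rw [e3]; group }
  have : K = ⊤ := hgen K (fun a ha => ⟨0, 0, a, ha, by simp⟩)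
    ⟨0, 1, 1, one_mem _, by simp⟩
  have hx : x ∈ K := this ▸ Subgroup.mem_top x
  exact hx

theorem aux_inj {X Y : Type*} [Group X] [Group Y] (A : Subgroup X) (s : X)
    (hgen : ∀ K : Subgroup X, A ≤ K → s ∈ K → K = ⊤)
    (hs : ∀ a ∈ A, s * a * s⁻¹ ∈ A) (f : X →* Y) (hf : ∀ a ∈ A, f a = 1 → a = 1)
    (φ : Y →* Multiplicative ℤ) (hA : ∀ a ∈ A, φ (f a) = 1)
    (hφ : φ (f s) = Multiplicative.ofAdd 1 ∨ φ (f s) = Multiplicative.ofAdd (-1)) :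
    Function.Injective f := by
  rw [injective_iff_map_eq_one]
  intro x hx
  obtain ⟨n, m, a, ha, rfl⟩ := aux_form A s hgen hs x
  have h1 : φ (f ((s ^ n)⁻¹ * a * s ^ m)) = 1 := by rw [hx, map_one]
  have hnm : n = m := by
    simp only [map_mul, map_inv, map_pow, hA a ha] at h1
    have h2 := congrArg Multiplicative.toAdd h1
    rcases hφ with h | h <;> rw [h] at h2 <;> simp at h2 <;> omega
  subst hnm
  have : f a = 1 := by
    simp only [map_mul, map_inv, map_pow] at hx
    rw [mul_assoc, inv_mul_eq_one] at hx
    exact mul_eq_right.1 hx.symm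
  simp [hf a ha this]

open HNNExtension in
theorem aux_split {H : Type u} [Group H] (φ : H →* Multiplicative ℤ) (A : Subgroup H) (s : H)
    (hgen : ∀ K : Subgroup H, A ≤ K → s ∈ K → K = ⊤)
    (hs : (∀ a ∈ A, s * a * s⁻¹ ∈ A) ∨ (∀ a ∈ A, s⁻¹ * a * s ∈ A))
    (hA : ∀ a ∈ A, φ a = 1) (hφ : φ s = Multiplicative.ofAdd 1) :
    SplitsAsHNNRealising H φ A := by
  let C : Subgroup A := (A.comap (MulAut.conj s).toMonoidHom).subgroupOf A
  let D : Subgroup A := (A.comap (MulAut.conj s⁻¹).toMonoidHom).subgroupOf A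
  have hC : ∀ a : A, a ∈ C ↔ s * a * s⁻¹ ∈ A := fun a => by
    simp [C, Subgroup.mem_subgroupOf]
  have hD : ∀ a : A, a ∈ D ↔ s⁻¹ * a * s ∈ A := fun a => by
    simp [D, Subgroup.mem_subgroupOf]
  let ψ : C ≃* D :=
    { toFun := fun c => ⟨⟨s * c * s⁻¹, (hC _).1 c.2⟩, (hD _).2 (by simp [mul_assoc])⟩
      invFun := fun c => ⟨⟨s⁻¹ * c * s, (hD _).1 c.2⟩, (hC _).2 (by simp [mul_assoc])⟩
      left_inv := fun c => by ext; simp [mul_assoc]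
      right_inv := fun c => by ext; simp [mul_assoc]
      map_mul' := fun c d => by ext; simp [mul_assoc] }
  let f : HNNExtension A C D ψ →* H := lift A.subtype s (fun c => by simp [ψ])
  have hft : f t = s := lift_t _ _ _
  have hfo : ∀ a : A, f (of a) = a := fun a => lift_of _ _ _ a
  have hsurj : Function.Surjective f := by
    rw [← MonoidHom.range_eq_top]
    exact hgen _ (fun a ha => ⟨of ⟨a, ha⟩, hfo _⟩) ⟨t, hft⟩
  have hgen' : ∀ K : Subgroup (HNNExtension A C D ψ), (of : A →* HNNExtension A C D ψ).range ≤ K →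
      t ∈ K → K = ⊤ := by
    intro K h1 h2
    rw [Subgroup.eq_top_iff']
    intro x
    induction x using HNNExtension.induction_on with
    | of g => exact h1 ⟨g, rfl⟩
    | t => exact h2
    | mul x y hx hy => exact mul_mem hx hy
    | inv x hx => exact inv_mem hx
  have h1 : ∀ a ∈ (of : A →* HNNExtension A C D ψ).range, f a = 1 → a = 1 := by
    rintro _ ⟨a, rfl⟩ h
    rw [hfo] at h
    rw [show a = 1 from Subtype.ext h, map_one]
  have h2 : ∀ a ∈ (of : A →* HNNExtension A C D ψ).range, φ (f a) = 1 := by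
    rintro _ ⟨a, rfl⟩
    rw [hfo]; exact hA a a.2
  have hinj : Function.Injective f := by
    rcases hs with hs | hs
    · refine aux_inj _ t hgen' ?_ f h1 φ h2 (Or.inl (by rw [hft, hφ]))
      rintro _ ⟨a, rfl⟩
      exact ⟨ψ ⟨a, (hC a).2 (hs a a.2)⟩, equiv_eq_conj (φ := ψ) ⟨a, (hC a).2 (hs a a.2)⟩⟩
    · refine aux_inj _ t⁻¹ (fun K hK ht => hgen' K hK (inv_mem_iff.1 ht)) ?_ f h1 φ h2
        (Or.inr (by rw [map_inv, hft, map_inv, hφ]; rfl))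
      rintro _ ⟨a, rfl⟩
      rw [inv_inv]
      exact ⟨ψ.symm ⟨a, (hD a).2 (hs a a.2)⟩,
        equiv_symm_eq_conj (φ := ψ) ⟨a, (hD a).2 (hs a a.2)⟩⟩
  refine ⟨C, D, ψ, MulEquiv.ofBijective f ⟨hinj, hsurj⟩, hfo, hA, ?_⟩
  change φ (f t) = _
  rw [hft, hφ]

theorem aux_lift {G Q : Type*} [Group G] [Group Q] (ρ : G →* Q) (hρ : Function.Surjective ρ)
    (K : Subgroup Q) (hK : K.FG) : ∃ H : Subgroup G, H.FG ∧ H.map ρ = K := by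
  classical
  obtain ⟨S, rfl⟩ := hK
  obtain ⟨σ, hσ⟩ := hρ.hasRightInverse
  refine ⟨Subgroup.closure (S.image σ : Finset G), ⟨_, rfl⟩, ?_⟩
  rw [MonoidHom.map_closure]
  congr 1
  ext x
  simp only [Finset.coe_image, Set.mem_image, SetLike.mem_coe, exists_exists_and_eq_and, hσ _]
  simp

/-- If `G` is an indicably coherent group containing no non-abelian free subgroup, then every
quotient group of `G` is also indicably coherent. -/
theorem indicablyCoherent_quotient (G : Type u) [Group G]
    (hic : IndicablyCoherent G)
    (hfree : ¬ ∃ f : FreeGroup (Fin 2) →* G, Function.Injective f)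
    (Q : Type u) [Group Q] (ρ : G →* Q) (hρ : Function.Surjective ρ) :
    IndicablyCoherent Q := by
  intro K hK φ hφ
  obtain ⟨H, hH, hHK⟩ := aux_lift ρ hρ K ((Group.fg_iff_subgroup_fg K).1 hK)
  let π : H →* K := (ρ.comp H.subtype).codRestrict K
    (fun x => hHK ▸ Subgroup.mem_map_of_mem ρ x.2)
  have hπ : Function.Surjective π := by
    rintro ⟨k, hk⟩
    rw [← hHK] at hk
    obtain ⟨x, hx, rfl⟩ := hk
    exact ⟨⟨x, hx⟩, rfl⟩
  obtain ⟨A, hA, C, D, ψ, e, he, hker, ht⟩ :=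
    hic H ((Group.fg_iff_subgroup_fg H).2 hH) (φ.comp π) (hφ.comp hπ)
  have hCD : (∀ a, a ∈ C) ∨ (∀ b, b ∈ D) := by
    by_contra! hcon
    obtain ⟨⟨a, ha⟩, b, hb⟩ := hcon
    obtain ⟨f, hf⟩ := aux_free ψ a b ha hb
    exact hfree ⟨H.subtype.comp (e.toMonoidHom.comp f),
      H.subtype_injective.comp (e.injective.comp hf)⟩
  refine ⟨A.map π, ?_, aux_split φ (A.map π) (π (e HNNExtension.t)) ?_ ?_ ?_ ht⟩
  · haveI := hA
    exact Group.fg_of_surjective (π.subgroupMap_surjective A)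
  · intro L h1 h2
    rw [Subgroup.eq_top_iff']
    intro x
    obtain ⟨y, rfl⟩ := hπ x
    obtain ⟨z, rfl⟩ := e.surjective y
    induction z using HNNExtension.induction_on with
    | of g => rw [he]; exact h1 (Subgroup.mem_map_of_mem π g.2)
    | t => exact h2
    | mul x y hx hy => simpa using mul_mem hx hy
    | inv x hx => simpa using hx
  · rcases hCD with h | h
    · left
      rintro _ ⟨a, ha, rfl⟩
      have := HNNExtension.equiv_eq_conj (φ := ψ) ⟨⟨a, ha⟩, h _⟩
      have h3 := congrArg (fun x => π (e x)) this
      simp only [map_mul, map_inv, he] at h3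
      rw [← h3]
      exact Subgroup.mem_map_of_mem π (SetLike.coe_mem _)
    · right
      rintro _ ⟨a, ha, rfl⟩
      have := HNNExtension.equiv_symm_eq_conj (φ := ψ) ⟨⟨a, ha⟩, h _⟩
      have h3 := congrArg (fun x => π (e x)) this
      simp only [map_mul, map_inv, he] at h3
      rw [← h3]
      exact Subgroup.mem_map_of_mem π (SetLike.coe_mem _)
  · rintro _ ⟨a, ha, rfl⟩
    exact hker a ha
end

section
/- Let G be an ascending HNN extension with vertex group A and stable letter t, inducing the epimorphism phi from G onto the integers Z (the map killing the normal closure of A and sending t to 1). If rho is an epimorphism from G onto a group Q such that phi factors through rho, then Q is an ascending HNN extension with vertex group rho(A) and stable letter rho(t), and the induced epimorphism from Q to Z realised by this HNN decomposition is the map through which phi factors. -/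
universe u v

/-- Let `G` be an ascending HNN extension with vertex group `A` and stable letter `t`,
inducing the epimorphism `φ : G → ℤ` (whose kernel is the normal closure of `A` and which
sends `t` to `1`).  If `ρ : G → Q` is an epimorphism such that `φ` factors through `ρ`, say
`φ = ψ ∘ ρ`, then `Q` is an ascending HNN extension with vertex group `ρ(A)` and stable
letter `ρ(t)`, and the epimorphism `Q → ℤ` induced by this HNN decomposition is `ψ`. -/
theorem ascendingHNN_quotient (G : Type u) [Group G] (A : Subgroup G) (t : G)
    (hHNN : IsAscendingHNN G A t)
    (φ : G →* Multiplicative ℤ)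
    (hker : φ.ker = Subgroup.normalClosure (A : Set G))
    (hφt : φ t = Multiplicative.ofAdd 1)
    (Q : Type u) [Group Q] (ρ : G →* Q) (hρ : Function.Surjective ρ)
    (ψ : Q →* Multiplicative ℤ) (hfac : ψ.comp ρ = φ) :
    IsAscendingHNN Q (A.map ρ) (ρ t) ∧
      ψ.ker = Subgroup.normalClosure ((A.map ρ : Subgroup Q) : Set Q) ∧
      ψ (ρ t) = Multiplicative.ofAdd 1 := by
  obtain ⟨hgen, hconj⟩ := hHNN
  have hψ : ∀ g, ψ (ρ g) = φ g := fun g => by rw [← hfac]; rfl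
  refine ⟨⟨?_, ?_⟩, ?_, ?_⟩
  · have h := congrArg (Subgroup.map ρ) hgen
    rw [MonoidHom.map_closure, Set.image_union, Set.image_singleton,
      Subgroup.map_top_of_surjective ρ hρ] at h
    rw [Subgroup.coe_map]
    exact h
  · rintro _ ⟨a, ha, rfl⟩
    exact ⟨t * a * t⁻¹, hconj a ha, by simp⟩
  · rw [Subgroup.coe_map, ← Subgroup.map_normalClosure _ ρ hρ, ← hker]
    ext q
    constructor
    · intro hq
      obtain ⟨g, rfl⟩ := hρ q
      refine ⟨g, ?_, rfl⟩
      have h1 : ψ (ρ g) = 1 := hq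
      rw [hψ] at h1
      exact h1
    · rintro ⟨g, hg, rfl⟩
      have h1 : φ g = 1 := hg
      rw [MonoidHom.mem_ker, hψ, h1]
  · rw [hψ, hφt]
end

section
/- Every finitely generated free abelian group is cascading. -/
universe u v

/-- Cascading groups, defined by transfinite induction: a group is `0`-cascading iff it is
finite; for `α > 0` a group is `α`-cascading if it admits a finite-index subgroup `H` and an
epimorphism `φ : H → ℤ` such that for every splitting of `H` as an HNN extension realising
`φ`, if the vertex group is finitely generated then it is `β`-cascading for some `β < α`.
A group is cascading if it is `α`-cascading for some ordinal `α`; equivalently (by least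
fixed point semantics) it satisfies the following inductive predicate. -/
inductive Cascading : ∀ (G : Type u) [Group G], Prop
  | of_finite (G : Type u) [Group G] (h : Finite G) : Cascading G
  | step (G : Type u) [Group G] (H : Subgroup G) (hH : H.FiniteIndex)
      (φ : H →* Multiplicative ℤ) (hφ : Function.Surjective φ)
      (h : ∀ A : Subgroup H, SplitsAsHNNRealising H φ A → Group.FG A → Cascading A) :
      Cascading G
theorem cascading_of_embeds (n : ℕ) : ∀ (G : Type u) [Group G]
    (f : G →* Multiplicative (Fin n → ℤ)), Function.Injective f → Cascading G := by
  induction n with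
  | zero =>
    intro G _ f hf
    have : Finite (Multiplicative (Fin 0 → ℤ)) := inferInstanceAs (Finite (Fin 0 → ℤ))
    exact Cascading.of_finite G (Finite.of_injective f hf)
  | succ n ih =>
    intro G _ f hf
    let p : G →* Multiplicative ℤ :=
      (AddMonoidHom.toMultiplicative (Pi.evalAddMonoidHom (fun _ : Fin (n+1) => ℤ) 0)).comp f
    let q : G →* Multiplicative (Fin n → ℤ) :=
      (AddMonoidHom.toMultiplicative
        (AddMonoidHom.mk' (fun (v : Fin (n+1) → ℤ) (i : Fin n) => v i.succ)
          (fun _ _ => rfl))).comp f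
    have hpq : ∀ g, p g = 1 → q g = 1 → g = 1 := by
      intro g h1 h2
      apply hf
      rw [map_one]
      apply Multiplicative.toAdd.injective
      funext i
      refine Fin.cases ?_ (fun j => ?_) i
      · exact congrArg Multiplicative.toAdd h1
      · exact congrFun (congrArg Multiplicative.toAdd h2) j
    by_cases hp : p.range = ⊥
    · refine ih G q ((injective_iff_map_eq_one q).2 fun g hg => hpq g ?_ hg)
      have : p g ∈ p.range := ⟨g, rfl⟩
      rwa [hp, Subgroup.mem_bot] at this
    · have : Nontrivial p.range := (Subgroup.nontrivial_iff_ne_bot _).2 hp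
      have hinf : Infinite p.range := by
        obtain ⟨x, hx⟩ := exists_ne (1 : p.range)
        exact Infinite.of_injective (fun k : ℤ => x ^ k) (injective_zpow_iff_not_isOfFinOrder.2 (not_isOfFinOrder_of_isMulTorsionFree hx))
      let e : p.range ≃* Multiplicative ℤ := (intCyclicMulEquiv (G := p.range)).symm
      let φ : (⊤ : Subgroup G) →* Multiplicative ℤ :=
        e.toMonoidHom.comp (p.rangeRestrict.comp (Subgroup.subtype ⊤))
      refine Cascading.step G ⊤ inferInstance φ ?_ ?_
      · intro z
        obtain ⟨⟨_, g, rfl⟩, hg⟩ := e.surjective z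
        exact ⟨⟨g, trivial⟩, hg⟩
      · rintro A ⟨C, D, ψ, e', -, hA, -⟩ -
        refine ih A (q.comp ((Subgroup.subtype ⊤).comp A.subtype))
          ((injective_iff_map_eq_one _).2 fun a ha => ?_)
        apply Subtype.ext
        apply Subtype.ext
        refine hpq _ ?_ ha
        have h1 := hA a a.2
        have h2 := e.map_eq_one_iff.1 h1
        exact congrArg Subtype.val h2

/-- Every finitely generated free abelian group is cascading. -/
theorem cascading_of_finitelyGeneratedFreeAbelian (G : Type u) [Group G] (n : ℕ)
    (h : Nonempty (G ≃* Multiplicative (Fin n → ℤ))) : Cascading G := by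
  obtain ⟨e⟩ := h
  exact cascading_of_embeds n G e.toMonoidHom e.injective
end

section
/- Let alpha and beta be ordinals with beta < alpha. Let G be a finitely generated group in the class EA_alpha of the elementary amenable hierarchy, and suppose G fits into a short exact sequence K -> G -> Q where K lies in EA_beta. If Q is cascading and every finitely generated group in EA_beta is cascading, then G is cascading. -/
universe u v

/-- The elementary amenable hierarchy `EA_α`, defined by transfinite recursion: `EA_0` is the
class of groups that are finite or abelian; for `α > 0`, `EA_α` is the class of groups that
are directed unions of subgroups lying in classes `EA_{βᵢ}` with `βᵢ < α`, or extensions of a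
group in `EA_β` by a group in `EA_β` for some `β < α`. -/
noncomputable def EAHier : Ordinal.{u} → ∀ (G : Type u) [Group G], Prop :=
  Ordinal.lt_wf.fix fun α rec G _ =>
    if α = 0 then Finite G ∨ (∀ a b : G, a * b = b * a)
    else
      (∃ (ι : Type u) (S : ι → Subgroup G) (β : ι → Ordinal.{u}),
        Directed (· ≤ ·) S ∧ (∀ g : G, ∃ i, g ∈ S i) ∧
        ∀ i, ∃ h : β i < α, rec (β i) h (S i)) ∨
      (∃ (β : Ordinal.{u}) (h : β < α) (N : Subgroup G) (hN : N.Normal),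
        rec β h N ∧ @rec β h (G ⧸ N) (@QuotientGroup.Quotient.group G _ N hN))
theorem EAHier_eq (α : Ordinal.{u}) (G : Type u) [Group G] : EAHier α G =
    (if α = 0 then Finite G ∨ (∀ a b : G, a * b = b * a)
    else
      (∃ (ι : Type u) (S : ι → Subgroup G) (β : ι → Ordinal.{u}),
        Directed (· ≤ ·) S ∧ (∀ g : G, ∃ i, g ∈ S i) ∧
        ∀ i, ∃ _h : β i < α, EAHier (β i) (S i)) ∨
      (∃ (β : Ordinal.{u}) (_h : β < α) (N : Subgroup G) (hN : N.Normal),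
        EAHier β N ∧ @EAHier β (G ⧸ N) (@QuotientGroup.Quotient.group G _ N hN))) := by
  unfold EAHier
  rw [WellFounded.fix_eq]

theorem EAHier_inj (α : Ordinal.{u}) : ∀ (G H : Type u) [Group G] [Group H] (f : H →* G),
    Function.Injective f → EAHier α G → EAHier α H := by
  induction α using WellFoundedLT.induction with
  | ind α ih =>
  intro G H _ _ f hf hG
  rw [EAHier_eq] at hG ⊢
  split_ifs with h0
  · rw [if_pos h0] at hG
    rcases hG with h | h
    · exact Or.inl (Finite.of_injective f hf)
    · exact Or.inr fun a b => hf (by rw [map_mul, map_mul, h])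
  · rw [if_neg h0] at hG
    rcases hG with ⟨ι, S, β, hd, hc, hS⟩ | ⟨β, hβ, N, hN, h1, h2⟩
    · left
      refine ⟨ι, fun i => (S i).comap f, β, ?_, fun g => hc (f g), fun i => ?_⟩
      · intro i j
        obtain ⟨k, h1, h2⟩ := hd i j
        exact ⟨k, Subgroup.comap_mono h1, Subgroup.comap_mono h2⟩
      · obtain ⟨hi, hh⟩ := hS i
        refine ⟨hi, ih _ hi (S i) _ (f.subgroupComap (S i)) ?_ hh⟩
        intro a b hab
        exact Subtype.ext (hf (congrArg Subtype.val hab))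
    · right
      refine ⟨β, hβ, N.comap f, inferInstance, ?_, ?_⟩
      · refine ih _ hβ N _ (f.subgroupComap N) ?_ h1
        intro a b hab
        exact Subtype.ext (hf (congrArg Subtype.val hab))
      · refine ih _ hβ (G ⧸ N) _ (QuotientGroup.map (N.comap f) N f le_rfl) ?_ h2
        rw [← MonoidHom.ker_eq_bot_iff, eq_bot_iff]
        intro x
        induction x using QuotientGroup.induction_on with
        | H z =>
        intro hz
        rw [MonoidHom.mem_ker, QuotientGroup.map_mk, QuotientGroup.eq_one_iff] at hz
        rw [Subgroup.mem_bot, QuotientGroup.eq_one_iff]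
        exact hz

theorem free_solvable_subsingleton {ι G : Type*} [Group G] (b : FreeGroupBasis ι G) (hs : Group.IsSolvable G) :
    Subsingleton ι := by
  classical
  refine ⟨fun i j => ?_⟩
  by_contra hij
  let σ : Equiv.Perm (Fin 5) := finRotate 5
  let f : G →* Equiv.Perm (Fin 5) := b.lift (fun k => if k = i then σ else Equiv.swap 0 (σ 0))
  have hi : f (b i) = σ := by simp [f]
  have hj : f (b j) = Equiv.swap 0 (σ 0) := by simp [f, Ne.symm hij]
  have hf : Function.Surjective f := by
    rw [← MonoidHom.range_eq_top, eq_top_iff,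
      ← Equiv.Perm.closure_cycle_adjacent_swap (isCycle_finRotate (n := 3)) support_finRotate (0 : Fin 5),
      Subgroup.closure_le]
    rintro x (rfl | rfl)
    · exact ⟨_, hi⟩
    · exact ⟨_, hj⟩
  exact Equiv.Perm.not_isSolvable_fin_5 (Group.isSolvable_of_surjective hf)

theorem free_comm_cyclic {ι G : Type*} [Group G] (b : FreeGroupBasis ι G) [Subsingleton ι] :
    ∃ c : G, ∀ x : G, ∃ n : ℤ, x = c ^ n := by
  suffices h : ∃ c : FreeGroup ι, ∀ x, ∃ n : ℤ, x = c ^ n by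
    obtain ⟨c, hc⟩ := h
    refine ⟨b.repr.symm c, fun x => ?_⟩
    obtain ⟨n, hn⟩ := hc (b.repr x)
    exact ⟨n, by rw [← map_zpow, ← hn]; simp⟩
  rcases isEmpty_or_nonempty ι with h | ⟨⟨i⟩⟩
  · exact ⟨1, fun x => ⟨0, Subsingleton.elim _ _⟩⟩
  · refine ⟨FreeGroup.of i, fun x => ?_⟩
    suffices x ∈ Subgroup.zpowers (FreeGroup.of i) by
      obtain ⟨n, hn⟩ := this
      exact ⟨n, hn.symm⟩
    induction x using FreeGroup.induction_on with
    | C1 => exact one_mem _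
    | of j => rw [Subsingleton.elim j i]; exact Subgroup.mem_zpowers _
    | inv_of j h => exact inv_mem h
    | mul x y hx hy => exact mul_mem hx hy

/-- An abelian normal subgroup of a nonabelian free group is trivial. -/
theorem free_abelian_normal {ι G : Type u} [Group G] (b : FreeGroupBasis ι G) (i j : ι) (hij : i ≠ j)
    (N : Subgroup G) [N.Normal] (hN : ∀ x y : N, x * y = y * x) (x : G) (hx : x ∈ N) : x = 1 := by
  classical
  have key : ∀ g : G, ∃ (c : G) (m n : ℤ), x = c ^ m ∧ g = c ^ n := by
    intro g
    let π := QuotientGroup.mk' N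
    let M : Subgroup G := (Subgroup.zpowers (π g)).comap π
    have hNM : N ≤ M := by
      intro y hy
      have : π y = 1 := (QuotientGroup.eq_one_iff y).2 hy
      show π y ∈ Subgroup.zpowers (π g)
      rw [this]; exact one_mem _
    have := b.isFreeGroup
    have hsN : Group.IsSolvable N := Group.isSolvable_of_comm hN
    have hsZ : Group.IsSolvable (Subgroup.zpowers (π g)) := Group.isSolvable_of_comm (by
      rintro ⟨_, m, rfl⟩ ⟨_, n, rfl⟩
      apply Subtype.ext
      show π g ^ m * π g ^ n = π g ^ n * π g ^ m
      rw [← zpow_add, ← zpow_add, add_comm])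
    have hsM : Group.IsSolvable M := by
      refine Group.isSolvable_of_ker_le_range (Subgroup.inclusion hNM) (π.subgroupComap (Subgroup.zpowers (π g))) ?_
      rintro ⟨y, hy⟩ h
      have h' : π y = 1 := congrArg Subtype.val h
      exact ⟨⟨y, (QuotientGroup.eq_one_iff y).1 h'⟩, rfl⟩
    obtain ⟨κ, ⟨bM⟩⟩ := (subgroupIsFreeOfIsFree M).nonempty_basis
    have := free_solvable_subsingleton bM hsM
    obtain ⟨c, hc⟩ := free_comm_cyclic bM
    obtain ⟨m, hm⟩ := hc ⟨x, hNM hx⟩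
    obtain ⟨n, hn⟩ := hc ⟨g, Subgroup.mem_zpowers (π g)⟩
    exact ⟨c, m, n, by simpa using congrArg Subtype.val hm, by simpa using congrArg Subtype.val hn⟩
  have key2 : ∀ k : ι, ∃ m : ℤ, x = b k ^ m := by
    intro k
    obtain ⟨c, m, n, h1, h2⟩ := key (b k)
    let f : G →* Multiplicative ℤ := b.lift (fun _ => Multiplicative.ofAdd 1)
    have hf : f (b k) = Multiplicative.ofAdd 1 := by simp [f]
    rw [h2, map_zpow] at hf
    have hf' : n * (f c).toAdd = 1 := by
      simpa using congrArg Multiplicative.toAdd hf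
    rcases Int.eq_one_or_neg_one_of_mul_eq_one hf' with h | h
    · exact ⟨m, by rw [h2, h1, h, zpow_one]⟩
    · refine ⟨-m, by rw [h2, h1, h]; simp⟩
  obtain ⟨m, hm⟩ := key2 i
  obtain ⟨n, hn⟩ := key2 j
  let f : G →* Multiplicative ℤ := b.lift (fun k => if k = i then Multiplicative.ofAdd 1 else 1)
  have hfi : f (b i) = Multiplicative.ofAdd 1 := by simp [f]
  have hfj : f (b j) = 1 := by simp [f, Ne.symm hij]
  have h1 : f x = Multiplicative.ofAdd m := by
    rw [hm, map_zpow, hfi, ← ofAdd_zsmul]; simp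
  have h2 : f x = 1 := by rw [hn, map_zpow, hfj, one_zpow]
  have : m = 0 := by
    rw [h2] at h1
    exact (congrArg Multiplicative.toAdd h1).symm
  rw [hm, this, zpow_zero]

theorem EAHier_free (α : Ordinal.{u}) : ∀ (G : Type u) [Group G], IsFreeGroup G →
    EAHier α G → ∀ x y : G, x * y = y * x := by
  induction α using WellFoundedLT.induction with
  | ind α ih =>
  intro G _ hfree hG
  obtain ⟨ι, ⟨b⟩⟩ := hfree.nonempty_basis
  by_cases hι : Subsingleton ι
  · obtain ⟨c, hc⟩ := free_comm_cyclic b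
    intro x y
    obtain ⟨m, rfl⟩ := hc x
    obtain ⟨n, rfl⟩ := hc y
    rw [← zpow_add, ← zpow_add, add_comm]
  rw [not_subsingleton_iff_nontrivial] at hι
  obtain ⟨i, j, hij⟩ := hι.exists_pair_ne
  rw [EAHier_eq] at hG
  split_ifs at hG with h0
  · rcases hG with h | h
    · exfalso
      have : Nonempty ι := ⟨i⟩
      have : Finite (FreeGroup ι) := Finite.of_equiv G b.repr.toEquiv
      exact not_finite (FreeGroup ι)
    · exact h
  · rcases hG with ⟨κ, S, β, hd, hc, hS⟩ | ⟨β, hβ, N, hN, h1, h2⟩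
    · intro x y
      obtain ⟨p, hp⟩ := hc x
      obtain ⟨q, hq⟩ := hc y
      obtain ⟨k, h1, h2⟩ := hd p q
      obtain ⟨hk, hh⟩ := hS k
      exact congrArg Subtype.val (ih _ hk (S k) inferInstance hh ⟨x, h1 hp⟩ ⟨y, h2 hq⟩)
    · have hc := ih _ hβ N inferInstance h1
      refine ih _ hβ G hfree (EAHier_inj β _ _ (QuotientGroup.mk' N) ?_ h2)
      rw [← MonoidHom.ker_eq_bot_iff, QuotientGroup.ker_mk', eq_bot_iff]
      intro x hx
      exact free_abelian_normal b i j hij N hc x hx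

section HNNFree
variable {V : Type u} [Group V] {C D : Subgroup V} (ψ : C ≃* D)

/-- left factor -/
def lfac (c d : V) : Bool × Bool → V
  | (true, _) => 1
  | (false, true) => d
  | (false, false) => c⁻¹

/-- right factor -/
def rfac (c d : V) : Bool × Bool → V
  | (true, _) => 1
  | (false, true) => c
  | (false, false) => d⁻¹

/-- sign -/
def sgnB : Bool → ℤˣ
  | true => 1
  | false => -1

/-- left factor of the head -/
def lhead (c d : V) : List (Bool × Bool) → V
  | [] => 1
  | x :: _ => lfac c d x

/-- translated word -/
def trw (c d : V) : List (Bool × Bool) → List (ℤˣ × V)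
  | [] => []
  | x :: l => (sgnB x.2, rfac c d x * lhead c d l) :: trw c d l

theorem trw_chain (c d : V) (hc : c ∉ C) (hd : d ∉ D) : ∀ l : List (Bool × Bool),
    FreeGroup.IsReduced l →
    (trw c d l).IsChain (fun a b => a.2 ∈ HNNExtension.toSubgroup C D a.1 → a.1 = b.1)
  | [], _ => List.isChain_nil
  | [x], _ => List.isChain_singleton _
  | x :: y :: l, h => by
    rw [FreeGroup.isReduced_cons_cons] at h
    have ih := trw_chain c d hc hd (y :: l) h.2
    simp only [trw] at ih ⊢
    rw [List.isChain_cons_cons]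
    refine ⟨?_, ih⟩
    obtain ⟨x1, x2⟩ := x
    obtain ⟨y1, y2⟩ := y
    have h1 := h.1
    cases x1 <;> cases x2 <;> cases y1 <;> cases y2 <;>
      simp_all [sgnB, rfac, lfac, lhead]

/-- the homomorphism from the free group of rank two -/
def freeHom (c d : V) : FreeGroup Bool →* HNNExtension V C D ψ :=
  FreeGroup.lift (fun b => if b then HNNExtension.t
    else HNNExtension.of d * HNNExtension.t * HNNExtension.of c)

theorem freeHom_mk (c d : V) : ∀ l : List (Bool × Bool),
    freeHom ψ c d (FreeGroup.mk l) = HNNExtension.of (lhead c d l) *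
      ((trw c d l).map (fun x => HNNExtension.t ^ (x.1 : ℤ) * HNNExtension.of x.2)).prod
  | [] => by
    have : (FreeGroup.mk [] : FreeGroup Bool) = 1 := rfl
    simp [this, lhead, trw]
  | x :: l => by
    have ih := freeHom_mk c d l
    have : (FreeGroup.mk (x :: l) : FreeGroup Bool) = FreeGroup.mk [x] * FreeGroup.mk l := by
      simp
    rw [this, map_mul, ih]
    obtain ⟨x1, x2⟩ := x
    cases x1 <;> cases x2 <;>
      simp [freeHom, trw, lhead, lfac, rfac, sgnB, mul_assoc]

theorem freeHom_injective (c d : V) (hc : c ∉ C) (hd : d ∉ D) :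
    Function.Injective (freeHom ψ c d) := by
  rw [injective_iff_map_eq_one]
  intro x hx
  let w : HNNExtension.NormalWord.ReducedWord V C D :=
    ⟨lhead c d x.toWord, trw c d x.toWord, trw_chain c d hc hd _ FreeGroup.isReduced_toWord⟩
  have hw : w.prod ψ = 1 := by
    rw [← hx]
    conv_rhs => rw [← FreeGroup.mk_toWord (x := x), freeHom_mk]
    rfl
  have h := HNNExtension.ReducedWord.toList_eq_nil_of_mem_of_range ψ w (by rw [hw]; exact one_mem _)
  have h2 : trw c d x.toWord = [] := h
  rw [← FreeGroup.toWord_eq_nil_iff]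
  cases hl : x.toWord with
  | nil => rfl
  | cons a l => rw [hl] at h2; simp [trw] at h2

end HNNFree

/-- internal description of ascending splittings -/
def AscData_s11 (H : Type u) [Group H] (φ : H →* Multiplicative ℤ) (V : Subgroup H) (τ : H) : Prop :=
  φ τ = Multiplicative.ofAdd 1 ∧ (∀ v ∈ V, φ v = 1) ∧
  (∀ x : H, x ∈ Subgroup.closure ((V : Set H) ∪ {τ})) ∧
  ((∀ v ∈ V, τ * v * τ⁻¹ ∈ V) ∨ (∀ v ∈ V, τ⁻¹ * v * τ ∈ V))

theorem ascData_of_splits (α : Ordinal.{u}) (H : Type u) [Group H] (hEA : EAHier α H)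
    (φ : H →* Multiplicative ℤ) (V : Subgroup H) (h : SplitsAsHNNRealising H φ V) :
    ∃ τ, AscData_s11 H φ V τ := by
  obtain ⟨C, D, ψ, e, h1, h2, h3⟩ := h
  refine ⟨e HNNExtension.t, h3, h2, ?_, ?_⟩
  · intro x
    obtain ⟨y, rfl⟩ := e.surjective x
    induction y using HNNExtension.induction_on with
    | of g => rw [h1]; exact Subgroup.subset_closure (Or.inl g.2)
    | t => exact Subgroup.subset_closure (Or.inr rfl)
    | mul x y hx hy => rw [map_mul]; exact mul_mem hx hy
    | inv x hx => rw [map_inv]; exact inv_mem hx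
  by_cases hC : ∀ c, c ∈ C
  · left
    intro v hv
    have := congrArg e (HNNExtension.equiv_eq_conj (φ := ψ) ⟨⟨v, hv⟩, hC _⟩)
    simp only [map_mul, map_inv, h1] at this
    rw [← this]
    exact Subtype.property _
  by_cases hD : ∀ c, c ∈ D
  · right
    intro v hv
    have := congrArg e (HNNExtension.equiv_symm_eq_conj (φ := ψ) ⟨⟨v, hv⟩, hD _⟩)
    simp only [map_mul, map_inv, h1] at this
    rw [← this]
    exact Subtype.property _
  exfalso
  push Not at hC hD
  obtain ⟨c, hc⟩ := hC
  obtain ⟨d, hd⟩ := hD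
  let f : FreeGroup Bool →* H := e.toMonoidHom.comp (freeHom ψ c d)
  have hf : Function.Injective f := e.injective.comp (freeHom_injective ψ c d hc hd)
  have hfree : IsFreeGroup f.range :=
    ((FreeGroupBasis.ofFreeGroup Bool).map (MonoidHom.ofInjective hf)).isFreeGroup
  have hcomm := EAHier_free α f.range hfree (EAHier_inj α _ _ f.range.subtype
    f.range.subtype_injective hEA)
  have := congrArg Subtype.val (hcomm ⟨_, FreeGroup.of true, rfl⟩ ⟨_, FreeGroup.of false, rfl⟩)
  simp only [Subgroup.coe_mul, ← map_mul] at this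
  have h4 := congrArg FreeGroup.toWord (hf this)
  revert h4
  decide

theorem asc_normal_form {E : Type*} [Group E] (A : Subgroup E) (t : E)
    (hgen : ∀ x : E, x ∈ Subgroup.closure ((A : Set E) ∪ {t}))
    (hasc : ∀ v ∈ A, t * v * t⁻¹ ∈ A) (x : E) :
    ∃ (m n : ℕ) (a : E), a ∈ A ∧ x = (t ^ m)⁻¹ * a * t ^ n := by
  have hpow : ∀ (m : ℕ), ∀ v ∈ A, t ^ m * v * (t ^ m)⁻¹ ∈ A := by
    intro m
    induction m with
    | zero => intro v hv; simpa using hv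
    | succ m ih =>
      intro v hv
      have := hasc _ (ih v hv)
      rw [pow_succ']
      simpa [mul_assoc] using this
  induction hgen x using Subgroup.closure_induction_left with
  | one => exact ⟨0, 0, 1, one_mem _, by simp⟩
  | mul_left y hy z _ ih =>
    obtain ⟨m, n, a, ha, rfl⟩ := ih
    rcases hy with hy | hy
    · refine ⟨m, n, (t ^ m * y * (t ^ m)⁻¹) * a, mul_mem (hpow m y hy) ha, by group⟩
    · obtain rfl : y = t := hy
      cases m with
      | zero => exact ⟨0, n + 1, y * a * y⁻¹, hasc a ha, by rw [pow_succ']; group⟩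
      | succ m => exact ⟨m, n, a, ha, by rw [pow_succ]; group⟩
  | inv_mul_cancel y hy z _ ih =>
    obtain ⟨m, n, a, ha, rfl⟩ := ih
    rcases hy with hy | hy
    · refine ⟨m, n, (t ^ m * y⁻¹ * (t ^ m)⁻¹) * a, mul_mem (hpow m _ (inv_mem hy)) ha, by group⟩
    · obtain rfl : y = t := hy
      exact ⟨m + 1, n, a, ha, by rw [pow_succ]; group⟩

theorem asc_injective {E H : Type*} [Group E] [Group H] (A : Subgroup E) (t : E)
    (hgen : ∀ x : E, x ∈ Subgroup.closure ((A : Set E) ∪ {t}))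
    (hasc : ∀ v ∈ A, t * v * t⁻¹ ∈ A) (f : E →* H) (hfA : ∀ a ∈ A, f a = 1 → a = 1)
    (φ : H →* Multiplicative ℤ) (hφA : ∀ a ∈ A, φ (f a) = 1) (hφt : (φ (f t)).toAdd ≠ 0) :
    Function.Injective f := by
  rw [injective_iff_map_eq_one]
  intro x hx
  obtain ⟨m, n, a, ha, rfl⟩ := asc_normal_form A t hgen hasc x
  have h := congrArg Multiplicative.toAdd (congrArg φ hx)
  simp only [map_mul, map_inv, map_pow, hφA a ha, map_one, toAdd_mul, toAdd_inv, toAdd_pow,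
    toAdd_one, nsmul_eq_mul] at h
  have h' : ((n : ℤ) - m) * (φ (f t)).toAdd = 0 := by linarith
  have hnm : m = n := by
    rcases mul_eq_zero.1 h' with h | h
    · omega
    · exact absurd h hφt
  subst hnm
  have : f a = 1 := by
    have h2 : f ((t ^ m)⁻¹ * a * t ^ m) = (f (t ^ m))⁻¹ * f a * f (t ^ m) := by simp
    rw [h2] at hx
    calc f a = f (t ^ m) * ((f (t ^ m))⁻¹ * f a * f (t ^ m)) * (f (t ^ m))⁻¹ := by group
      _ = 1 := by rw [hx]; group
  rw [hfA a ha this]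
  group

theorem splits_of_ascData (H : Type u) [Group H] (φ : H →* Multiplicative ℤ) (V : Subgroup H)
    (τ : H) (h : AscData_s11 H φ V τ) : SplitsAsHNNRealising H φ V := by
  obtain ⟨h1, h2, h3, h4⟩ := h
  let C : Subgroup V := (V.comap (MulAut.conj τ).toMonoidHom).subgroupOf V
  let D : Subgroup V := (V.comap (MulAut.conj τ⁻¹).toMonoidHom).subgroupOf V
  have hC : ∀ c : V, c ∈ C ↔ τ * c * τ⁻¹ ∈ V := fun c => Iff.rfl
  have hD : ∀ c : V, c ∈ D ↔ τ⁻¹ * c * τ ∈ V := fun c => by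
    have : τ⁻¹ * c * τ = τ⁻¹ * c * (τ⁻¹)⁻¹ := by simp
    rw [this]; exact Iff.rfl
  let ψ : C ≃* D :=
    { toFun := fun c => ⟨⟨τ * c * τ⁻¹, (hC c).1 c.2⟩, (hD _).2 (by
        have : τ⁻¹ * (τ * c * τ⁻¹) * τ = ((c : V) : H) := by group
        simp only [this]; exact (c : V).2)⟩
      invFun := fun c => ⟨⟨τ⁻¹ * c * τ, (hD c).1 c.2⟩, (hC _).2 (by
        have : τ * (τ⁻¹ * c * τ) * τ⁻¹ = ((c : V) : H) := by group
        simp only [this]; exact (c : V).2)⟩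
      left_inv := fun c => by
        apply Subtype.ext; apply Subtype.ext
        show τ⁻¹ * (τ * c * τ⁻¹) * τ = ((c : V) : H)
        group
      right_inv := fun c => by
        apply Subtype.ext; apply Subtype.ext
        show τ * (τ⁻¹ * c * τ) * τ⁻¹ = ((c : V) : H)
        group
      map_mul' := fun a b => by
        apply Subtype.ext; apply Subtype.ext
        show τ * (((a : V) : H) * ((b : V) : H)) * τ⁻¹ = (τ * a * τ⁻¹) * (τ * b * τ⁻¹)
        group }
  have hψ : ∀ c : C, (((ψ c : D) : V) : H) = τ * c * τ⁻¹ := fun c => rfl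
  let f : HNNExtension V C D ψ →* H := HNNExtension.lift V.subtype τ (fun a => by
    simp [hψ])
  have hft : f HNNExtension.t = τ := HNNExtension.lift_t _ _ _
  have hfo : ∀ v, f (HNNExtension.of v) = v := fun v => HNNExtension.lift_of _ _ _ _
  have hsurj : Function.Surjective f := by
    rw [← MonoidHom.range_eq_top, eq_top_iff]
    intro x _
    refine (Subgroup.closure_le _).2 ?_ (h3 x)
    rintro y (hy | rfl)
    · exact ⟨_, hfo ⟨y, hy⟩⟩
    · exact ⟨_, hft⟩
  let A : Subgroup (HNNExtension V C D ψ) := (HNNExtension.of).range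
  have hgen : ∀ x, x ∈ Subgroup.closure ((A : Set _) ∪ {(HNNExtension.t : HNNExtension V C D ψ)}) := by
    intro x
    induction x using HNNExtension.induction_on with
    | of g => exact Subgroup.subset_closure (Or.inl ⟨g, rfl⟩)
    | t => exact Subgroup.subset_closure (Or.inr rfl)
    | mul x y hx hy => exact mul_mem hx hy
    | inv x hx => exact inv_mem hx
  have hfA : ∀ a ∈ A, f a = 1 → a = 1 := by
    rintro _ ⟨v, rfl⟩ hv
    rw [hfo] at hv
    have : v = 1 := Subtype.ext hv
    rw [this, map_one]
  have hφA : ∀ a ∈ A, φ (f a) = 1 := by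
    rintro _ ⟨v, rfl⟩
    rw [hfo]; exact h2 _ v.2
  have hinj : Function.Injective f := by
    rcases h4 with h4 | h4
    · refine asc_injective A HNNExtension.t hgen ?_ f hfA φ hφA ?_
      · rintro _ ⟨v, rfl⟩
        exact ⟨_, HNNExtension.equiv_eq_conj (φ := ψ) ⟨v, (hC v).2 (h4 v v.2)⟩⟩
      · rw [hft, h1]; simp
    · refine asc_injective A HNNExtension.t⁻¹ ?_ ?_ f hfA φ hφA ?_
      · intro x
        refine (Subgroup.closure_le _).2 ?_ (hgen x)
        rintro y (hy | rfl)
        · exact Subgroup.subset_closure (Or.inl hy)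
        · have h5 : (HNNExtension.t : HNNExtension V C D ψ)⁻¹ ∈
              (A : Set (HNNExtension V C D ψ)) ∪ {HNNExtension.t⁻¹} := Or.inr rfl
          have := inv_mem (Subgroup.subset_closure h5)
          rwa [inv_inv] at this
      · rintro _ ⟨v, rfl⟩
        rw [inv_inv]
        exact ⟨_, HNNExtension.equiv_symm_eq_conj (φ := ψ) ⟨v, (hD v).2 (h4 v v.2)⟩⟩
      · rw [map_inv, hft, map_inv, h1]; simp
  refine ⟨C, D, ψ, MulEquiv.ofBijective f ⟨hinj, hsurj⟩, hfo, h2, ?_⟩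
  show φ (f HNNExtension.t) = _
  rw [hft, h1]

theorem splits_push (α : Ordinal.{u}) (H₁ H₂ : Type u) [Group H₁] [Group H₂] (hEA : EAHier α H₁)
    (f : H₁ →* H₂) (hf : Function.Surjective f) (φ₁ : H₁ →* Multiplicative ℤ)
    (φ₂ : H₂ →* Multiplicative ℤ) (hφ : ∀ x, φ₁ x = φ₂ (f x)) (V : Subgroup H₁)
    (h : SplitsAsHNNRealising H₁ φ₁ V) : SplitsAsHNNRealising H₂ φ₂ (V.map f) := by
  obtain ⟨τ, h1, h2, h3, h4⟩ := ascData_of_splits α H₁ hEA φ₁ V h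
  refine splits_of_ascData H₂ φ₂ _ (f τ) ⟨?_, ?_, ?_, ?_⟩
  · rw [← hφ, h1]
  · rintro _ ⟨v, hv, rfl⟩
    rw [← hφ, h2 v hv]
  · intro x
    obtain ⟨y, rfl⟩ := hf x
    have := Subgroup.mem_map_of_mem f (h3 y)
    rw [MonoidHom.map_closure, Set.image_union, Set.image_singleton] at this
    exact this
  · refine h4.imp ?_ ?_
    · rintro h _ ⟨v, hv, rfl⟩
      exact ⟨_, h v hv, by simp⟩
    · rintro h _ ⟨v, hv, rfl⟩
      exact ⟨_, h v hv, by simp⟩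

theorem cascading_virt (α : Ordinal.{u}) (K : Type u) [Group K] (hK : Cascading K) :
    ∀ (G : Type u) [Group G] (_ : EAHier α G) (f : K →* G) (_ : Function.Injective f)
      (_ : f.range.FiniteIndex), Cascading G := by
  induction hK with
  | of_finite K h =>
    intro G _ _ f _ hfi
    refine Cascading.of_finite G ?_
    have : Finite f.range := Finite.of_surjective _ f.rangeRestrict_surjective
    exact (Subgroup.finite_iff_finite_and_finiteIndex f.range).2 ⟨this, hfi⟩
  | step K H hH φ hφ h ih =>
    intro G _ hG f hf hfi
    let e : H ≃* H.map f := H.equivMapOfInjective f hf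
    have hfi' : (H.map f).FiniteIndex := ⟨by
      rw [H.index_map_of_injective hf]
      exact mul_ne_zero hH.index_ne_zero hfi.index_ne_zero⟩
    have hEA1 : EAHier α (H.map f) := EAHier_inj α _ _ (H.map f).subtype
      (H.map f).subtype_injective hG
    refine Cascading.step G (H.map f) hfi' (φ.comp e.symm.toMonoidHom)
      (hφ.comp e.symm.surjective) ?_
    intro A hA hfg
    have hsp := splits_push α _ _ hEA1 e.symm.toMonoidHom e.symm.surjective
      (φ.comp e.symm.toMonoidHom) φ (fun _ => rfl) A hA
    have hfg' : Group.FG (A.map e.symm.toMonoidHom) :=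
      Group.fg_of_surjective (e.symm.toMonoidHom.subgroupMap_surjective A)
    let e2 : A ≃* A.map e.symm.toMonoidHom := A.equivMapOfInjective _ e.symm.injective
    refine ih _ hsp hfg' A (EAHier_inj α _ _ A.subtype A.subtype_injective hEA1)
      e2.symm.toMonoidHom e2.symm.injective ?_
    have : e2.symm.toMonoidHom.range = ⊤ := MonoidHom.range_eq_top.2 e2.symm.surjective
    rw [this]; infer_instance

theorem cascading_ext (α β : Ordinal.{u})
    (hβ : ∀ (K : Type u) [Group K], EAHier β K → Group.FG K → Cascading K)
    (Q : Type u) [Group Q] (hQ : Cascading Q) :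
    ∀ (G : Type u) [Group G] (_ : Group.FG G) (_ : EAHier α G) (ρ : G →* Q)
      (_ : Function.Surjective ρ) (_ : EAHier β ρ.ker), Cascading G := by
  induction hQ with
  | of_finite Q h =>
    intro G _ hfg hG ρ hρ hK
    have : ρ.ker.FiniteIndex := ⟨by
      rw [Subgroup.index_ker]
      exact Nat.card_pos.ne'⟩
    refine cascading_virt α ρ.ker (hβ _ hK inferInstance) G hG ρ.ker.subtype
      ρ.ker.subtype_injective ?_
    rwa [Subgroup.range_subtype]
  | step Q H hH φ hφ h ih =>
    intro G _ hfg hG ρ hρ hK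
    let ρ' : H.comap ρ →* H := ρ.subgroupComap H
    have hρ' : Function.Surjective ρ' := ρ.subgroupComap_surjective_of_surjective H hρ
    have hEA1 : EAHier α (H.comap ρ) := EAHier_inj α _ _ (H.comap ρ).subtype
      (H.comap ρ).subtype_injective hG
    refine Cascading.step G (H.comap ρ) ⟨by
      rw [H.index_comap_of_surjective hρ]; exact hH.index_ne_zero⟩ (φ.comp ρ') (hφ.comp hρ') ?_
    intro A hA hfgA
    have hsp := splits_push α _ _ hEA1 ρ' hρ' (φ.comp ρ') φ (fun _ => rfl) A hA
    have hsur := ρ'.subgroupMap_surjective A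
    refine ih _ hsp (Group.fg_of_surjective hsur) A hfgA
      (EAHier_inj α _ _ A.subtype A.subtype_injective hEA1) (ρ'.subgroupMap A) hsur ?_
    let j : A →* G := (H.comap ρ).subtype.comp A.subtype
    have hj : Function.Injective j := (H.comap ρ).subtype_injective.comp A.subtype_injective
    refine EAHier_inj β ρ.ker _ ((j.comp (ρ'.subgroupMap A).ker.subtype).codRestrict ρ.ker ?_) ?_ hK
    · rintro ⟨x, hx⟩
      have h1 : ρ'.subgroupMap A x = 1 := hx
      have h2 := congrArg Subtype.val (congrArg Subtype.val h1)
      exact h2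
    · intro x y hxy
      have h1 : j x.1 = j y.1 := congrArg ρ.ker.subtype hxy
      exact Subtype.ext (hj h1)

/-- Let `β < α` be ordinals. Let `G` be a finitely generated group in `EA_α` fitting into a
short exact sequence `K → G → Q` with `K ∈ EA_β`.  If `Q` is cascading and every finitely
generated group in `EA_β` is cascading, then `G` is cascading. -/
theorem cascading_of_extension (α β : Ordinal.{u}) (hβα : β < α)
    (G : Type u) [Group G] (hfg : Group.FG G) (hG : EAHier α G)
    (Q : Type u) [Group Q] (ρ : G →* Q) (hρ : Function.Surjective ρ)
    (hK : EAHier β ρ.ker)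
    (hQ : Cascading Q)
    (hβ : ∀ (K : Type u) [Group K], EAHier β K → Group.FG K → Cascading K) :
    Cascading G := by

  exact cascading_ext α β hβ Q hQ G hfg hG ρ hρ hK
end

section
/- Every finitely generated elementary amenable group is cascading. -/
universe u v

/-- Elementary amenable groups: the smallest class (within a universe) containing all finite
and all abelian groups that is closed under group extensions, directed unions, and
isomorphisms. -/
inductive ElementaryAmenable : ∀ (G : Type u) [Group G], Prop
  | of_finite (G : Type u) [Group G] (h : Finite G) : ElementaryAmenable G
  | of_comm (G : Type u) [Group G] (h : ∀ a b : G, a * b = b * a) : ElementaryAmenable G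
  | of_mulEquiv (G H : Type u) [Group G] [Group H] (e : G ≃* H)
      (h : ElementaryAmenable G) : ElementaryAmenable H
  | of_extension (G : Type u) [Group G] (N : Subgroup G) (hN : N.Normal)
      (h1 : ElementaryAmenable N) (h2 : ElementaryAmenable (G ⧸ N)) : ElementaryAmenable G
  | of_directedUnion (G : Type u) [Group G] (ι : Type u) (S : ι → Subgroup G)
      (hdir : Directed (· ≤ ·) S) (hcov : ∀ g : G, ∃ i, g ∈ S i)
      (h : ∀ i, ElementaryAmenable (S i)) : ElementaryAmenable G
/-- Auxiliary strengthening of `Cascading`. -/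
inductive SC : ∀ (G : Type u) [Group G], Prop
  | of_finite (G : Type u) [Group G] (h : Finite G) : SC G
  | step (G : Type u) [Group G] (H : Type u) [Group H] (j : H →* G)
      (hj : Function.Injective j) (hH : j.range.FiniteIndex)
      (φ : H →* Multiplicative ℤ) (hφ : Function.Surjective φ)
      (h : ∀ (A : Type u) [Group A] (i : A →* H), Function.Injective i →
        (∀ a, φ (i a) = 1) → Group.FG A → SC A) : SC G

/-- All finitely generated subgroups are `SC`. -/
def XC (G : Type u) [Group G] : Prop :=
  ∀ (A : Type u) [Group A] (i : A →* G), Function.Injective i → Group.FG A → SC A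

theorem SC.cascading {G : Type u} [Group G] (h : SC G) : Cascading G := by
  induction h with
  | of_finite G h => exact Cascading.of_finite G h
  | step G H j hj hH φ hφ h ih =>
    let e := MonoidHom.ofInjective hj
    refine Cascading.step G j.range hH (φ.comp e.symm.toMonoidHom)
      (hφ.comp e.symm.surjective) ?_
    rintro A ⟨C, D, ψ, e', h1, h2, h3⟩ hA
    exact ih A (e.symm.toMonoidHom.comp A.subtype)
      (e.symm.injective.comp A.subtype_injective) (fun a => h2 a a.2) hA

theorem XC.mono {G K : Type u} [Group G] [Group K] (h : XC G) (f : K →* G)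
    (hf : Function.Injective f) : XC K :=
  fun A _ i hi hA => h A (f.comp i) (hf.comp hi) hA

theorem SC.of_finiteIndex {G K : Type u} [Group G] [Group K] (h : SC K) (f : K →* G)
    (hf : Function.Injective f) (hi : f.range.FiniteIndex) : SC G := by
  cases h with
  | of_finite _ h =>
    refine SC.of_finite G ?_
    have : Finite f.range := Finite.of_surjective _ f.rangeRestrict_surjective
    have := hi
    have : Finite (G ⧸ f.range) := Subgroup.finite_quotient_of_finiteIndex
    exact Finite.of_equiv _ (Subgroup.groupEquivQuotientProdSubgroup (s := f.range)).symm
  | step _ H j hj hH φ hφ h =>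
    refine SC.step G H (f.comp j) (hf.comp hj) ?_ φ hφ h
    rw [MonoidHom.range_comp]
    constructor
    rw [Subgroup.index_map_of_injective _ hf]
    exact mul_ne_zero hH.index_ne_zero hi.index_ne_zero

theorem SC.ext {Q : Type u} [Group Q] (hQ : SC Q) : ∀ (G : Type u) [Group G] (f : G →* Q),
    Function.Surjective f → XC f.ker → Group.FG G → SC G := by
  induction hQ with
  | of_finite Q h =>
    intro G _ f hf hk hG
    have hfi : f.ker.FiniteIndex := inferInstance
    have : Group.FG f.ker := inferInstance
    refine SC.of_finiteIndex (hk f.ker (MonoidHom.id _) Function.injective_id this)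
      f.ker.subtype f.ker.subtype_injective ?_
    rwa [Subgroup.range_subtype]
  | step Q H j hj hH φ hφ h ih =>
    intro G _ f hf hk hG
    let e := MonoidHom.ofInjective hj
    let K := j.range.comap f
    let p : K →* H := e.symm.toMonoidHom.comp (f.subgroupComap j.range)
    have hp : ∀ k : K, j (p k) = f k := fun k => by
      have : e (p k) = f.subgroupComap j.range k := e.apply_symm_apply _
      exact congrArg Subtype.val this
    have hps : Function.Surjective p := fun x => by
      obtain ⟨g, hg⟩ := hf (j x)
      refine ⟨⟨g, ⟨x, hg.symm⟩⟩, hj ?_⟩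
      rw [hp]; exact hg
    refine SC.step G K K.subtype K.subtype_injective ?_ (φ.comp p) (hφ.comp hps) ?_
    · rw [Subgroup.range_subtype]
      have := hH
      constructor
      rw [Subgroup.index_comap_of_surjective _ hf]
      exact hH.index_ne_zero
    · intro A _ i hi hA hfg
      let q := p.comp i
      have : Group.FG q.range := Group.fg_range q
      refine ih q.range q.range.subtype q.range.subtype_injective ?_ this A q.rangeRestrict
        q.rangeRestrict_surjective ?_ hfg
      · rintro ⟨_, a, rfl⟩
        exact hA a
      · have hmem : ∀ a : q.rangeRestrict.ker, ((i a : K) : G) ∈ f.ker := by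
          rintro ⟨a, ha⟩
          rw [MonoidHom.ker_rangeRestrict] at ha
          rw [MonoidHom.mem_ker, ← hp]
          have : p (i a) = 1 := ha
          simp [this]
        refine hk.mono (((K.subtype.comp i).comp q.rangeRestrict.ker.subtype).codRestrict
          f.ker hmem) ?_
        intro a b hab
        have : ((i a : K) : G) = (i b : K) := congrArg (fun x : f.ker => (x : G)) hab
        exact Subtype.ext (hi (Subtype.ext this))

theorem XC.ext {G Q : Type u} [Group G] [Group Q] (f : G →* Q) (hk : XC f.ker) (hQ : XC Q) :
    XC G := by
  intro A _ i hi hA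
  let q := f.comp i
  have : Group.FG q.range := Group.fg_range q
  refine SC.ext (hQ q.range q.range.subtype q.range.subtype_injective this) A
    q.rangeRestrict q.rangeRestrict_surjective ?_ hA
  have hmem : ∀ a : q.rangeRestrict.ker, i a ∈ f.ker := by
    rintro ⟨a, ha⟩
    rw [MonoidHom.ker_rangeRestrict] at ha
    exact ha
  refine hk.mono ((i.comp q.rangeRestrict.ker.subtype).codRestrict f.ker hmem) ?_
  intro a b hab
  exact Subtype.ext (hi (congrArg Subtype.val hab))

theorem XC.of_finite (G : Type u) [Group G] [Finite G] : XC G :=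
  fun A _ i hi _ => SC.of_finite A (Finite.of_injective i hi)

theorem XC.of_cyclic (G : Type u) [Group G] [IsCyclic G] : XC G := by
  intro A _ i hi _
  have : IsCyclic A := isCyclic_of_injective i hi
  by_cases hfin : Finite A
  · exact SC.of_finite A hfin
  · have : Infinite A := not_finite_iff_infinite.mp hfin
    obtain ⟨e⟩ : Nonempty (A ≃* Multiplicative ℤ) := by
      have h1 : Nat.card A = Nat.card (Multiplicative ℤ) := by
        rw [Nat.card_eq_zero_of_infinite, Nat.card_eq_zero_of_infinite]
      exact ⟨mulEquivOfCyclicCardEq h1⟩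
    refine SC.step A A (MonoidHom.id A) Function.injective_id ?_ e.toMonoidHom e.surjective ?_
    · rw [MonoidHom.range_eq_top.mpr Function.surjective_id]
      infer_instance
    · intro B _ k hk hB _
      refine SC.of_finite B ?_
      have : Subsingleton B := ⟨fun a b => hk (e.injective ((hB a).trans (hB b).symm))⟩
      infer_instance

theorem XC.of_directed (G : Type u) [Group G] (ι : Type u) (S : ι → Subgroup G)
    (hdir : Directed (· ≤ ·) S) (hcov : ∀ g : G, ∃ i, g ∈ S i)
    (h : ∀ i, XC (S i)) : XC G := by
  intro A _ i hi hA
  have hA' := hA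
  obtain ⟨T, hT⟩ := Group.fg_def.mp hA
  have : Nonempty ι := ⟨(hcov 1).choose⟩
  choose c hc using hcov
  obtain ⟨k, hk⟩ : ∃ k, ∀ t ∈ T, i t ∈ S k := by
    classical
    obtain ⟨k, hk⟩ := hdir.finset_le (T.image (fun t => c (i t)))
    exact ⟨k, fun t ht => hk _ (by exact Finset.mem_image.mpr ⟨t, ht, rfl⟩) (hc _)⟩
  have hle : ∀ a : A, i a ∈ S k := by
    have : (⊤ : Subgroup A) ≤ (S k).comap i := by
      rw [← hT, Subgroup.closure_le]
      exact hk
    exact fun a => this (Subgroup.mem_top a)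
  exact h k A (i.codRestrict (S k) hle) (fun a b hab => hi (congrArg Subtype.val hab)) hA'

theorem XC.of_closure (G : Type u) [CommGroup G] (T : Finset G) :
    XC (Subgroup.closure (T : Set G)) := by
  classical
  induction T using Finset.induction_on with
  | empty =>
    rw [Finset.coe_empty, Subgroup.closure_empty]
    exact XC.of_finite _
  | insert g T hg ih =>
    let N := Subgroup.closure (T : Set G)
    let M := Subgroup.closure ((insert g T : Finset G) : Set G)
    let Z := Subgroup.zpowers (QuotientGroup.mk g : G ⧸ N)
    have hM : M ≤ Z.comap (QuotientGroup.mk' N) := by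
      rw [Subgroup.closure_le]
      intro x hx
      rw [Finset.mem_coe, Finset.mem_insert] at hx
      rcases hx with rfl | hx
      · exact Subgroup.mem_zpowers _
      · have : (QuotientGroup.mk' N) x = 1 :=
          (QuotientGroup.eq_one_iff x).mpr (Subgroup.subset_closure hx)
        show (QuotientGroup.mk' N) x ∈ Z
        rw [this]; exact Z.one_mem
    let f : M →* Z := ((QuotientGroup.mk' N).comp M.subtype).codRestrict Z (fun m => hM m.2)
    refine XC.ext f ?_ (XC.of_cyclic Z)
    have hmem : ∀ a : f.ker, ((a : M) : G) ∈ N := by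
      rintro ⟨a, ha⟩
      have : (QuotientGroup.mk' N) (a : G) = 1 := congrArg Subtype.val ha
      exact (QuotientGroup.eq_one_iff _).mp this
    refine ih.mono ((M.subtype.comp f.ker.subtype).codRestrict N hmem) ?_
    intro a b hab
    exact Subtype.ext (Subtype.ext (congrArg (fun x : N => (x : G)) hab))

theorem XC.of_comm (G : Type u) [CommGroup G] : XC G := by
  classical
  refine XC.of_directed G (Finset G) (fun T => Subgroup.closure (T : Set G)) ?_ ?_
    (XC.of_closure G)
  · intro s t
    exact ⟨s ∪ t, Subgroup.closure_mono (by simp), Subgroup.closure_mono (by simp)⟩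
  · intro g
    exact ⟨{g}, Subgroup.subset_closure (by simp)⟩

theorem XC.of_elementaryAmenable {G : Type u} [Group G] (h : ElementaryAmenable G) : XC G := by
  induction h with
  | of_finite G h => exact XC.of_finite G
  | @of_comm G inst h =>
    exact @XC.of_comm G { inst with mul_comm := h }
  | of_mulEquiv G H e h ih => exact ih.mono e.symm.toMonoidHom e.symm.injective
  | of_extension G N hN h1 h2 ih1 ih2 =>
    refine XC.ext (QuotientGroup.mk' N) ?_ ih2
    rw [QuotientGroup.ker_mk']
    exact ih1
  | of_directedUnion G ι S hdir hcov h ih => exact XC.of_directed G ι S hdir hcov ih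

/-- Every finitely generated elementary amenable group is cascading. -/
theorem cascading_of_elementaryAmenable (G : Type u) [Group G]
    (hEA : ElementaryAmenable G) (hfg : Group.FG G) : Cascading G :=
  (XC.of_elementaryAmenable hEA G (MonoidHom.id G) Function.injective_id hfg).cascading
end
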